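/- arXiv:1506.04883 — 3 statements merged into one kernel-verified Lean document; each statement's English description precedes it below -/
import Mathlib

section
/- Let ψ ∈ C_c^∞(ℝ) satisfy ψ ≡ 1 on [−2,2] and supp ψ ⊆ [−4,4], let α > 0, and for ε ∈ (0,1] with m·arctan(ε) < π set a_ε(ξ) = (1 − ψ(P(ξ)^{1/m})) · (P(ξ) − (1+iε)^m)^{−α} (the base lies in ℂ∖(−∞,0] since Im((1+iε)^m) > 0). Then for every multi-index β there is a constant C_β, independent of ε, such that |∂^β_ξ a_ε(ξ)| ≤ C_β (1 + |ξ|)^{−mα − |β|} for all ξ ∈ ℝⁿ. -/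
open MeasureTheory Complex
open scoped ENNReal RealInnerProductSpace

noncomputable section

/-- The Fourier transform `f̂(ξ) = ∫ e^{−ix·ξ} f(x) dx`. -/
def FT {n : ℕ} (f : EuclideanSpace ℝ (Fin n) → ℂ) (ξ : EuclideanSpace ℝ (Fin n)) : ℂ :=
  ∫ x, Complex.exp (-Complex.I * (⟪x, ξ⟫ : ℂ)) * f x

/-- The inverse Fourier transform `𝓕⁻¹g(x) = (2π)^{−n} ∫ e^{ix·ξ} g(ξ) dξ`. -/
def IFT {n : ℕ} (g : EuclideanSpace ℝ (Fin n) → ℂ) (x : EuclideanSpace ℝ (Fin n)) : ℂ :=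
  (((2 * Real.pi) ^ n : ℝ) : ℂ)⁻¹ * ∫ ξ, Complex.exp (Complex.I * (⟪x, ξ⟫ : ℂ)) * g ξ

/-- The determinant of the Hessian matrix `(∂²f/∂ξᵢ∂ξⱼ)` of `f` at `ξ`. -/
def HessDet {n : ℕ} (f : EuclideanSpace ℝ (Fin n) → ℝ) (ξ : EuclideanSpace ℝ (Fin n)) : ℝ :=
  Matrix.det (Matrix.of fun i j : Fin n =>
    fderiv ℝ (fun y => fderiv ℝ f y (EuclideanSpace.single j 1)) ξ (EuclideanSpace.single i 1))


open scoped ContDiff in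
lemma aux_affine {E G : Type*} [NormedAddCommGroup E] [NormedSpace ℝ E]
    [NormedAddCommGroup G] [NormedSpace ℝ G] (F : G → ℂ) (U : Set G) (hU : IsOpen U)
    (hF : ContDiffOn ℝ ∞ F U) (L : E →L[ℝ] G) (b : G) (r : ℝ) (hL : ‖L‖ ≤ r) (k : ℕ) (x : E)
    (hx : L x + b ∈ U) :
    ‖iteratedFDeriv ℝ k (fun y => F (L y + b)) x‖ ≤ ‖iteratedFDeriv ℝ k F (L x + b)‖ * r ^ k := by
  set V : Set G := (fun z => z + b) ⁻¹' U with hV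
  have hVo : IsOpen V := hU.preimage (by fun_prop)
  have hFb : ContDiffOn ℝ ∞ (fun z => F (z + b)) V :=
    hF.comp (by fun_prop : ContDiff ℝ ∞ (fun z : G => z + b)).contDiffOn (fun z hz => hz)
  have hxV : L x ∈ V := hx
  have hLV : IsOpen (L ⁻¹' V) := hVo.preimage L.continuous
  have h1 := L.iteratedFDerivWithin_comp_right hFb hVo.uniqueDiffOn hLV.uniqueDiffOn hxV
    (i := k) (by exact_mod_cast le_top)
  rw [iteratedFDerivWithin_of_isOpen k hVo hxV, iteratedFDerivWithin_of_isOpen k hLV hxV,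
    iteratedFDeriv_comp_add_right] at h1
  change ‖iteratedFDeriv ℝ k ((fun z => F (z + b)) ∘ L) x‖ ≤ _
  rw [h1]
  refine (ContinuousMultilinearMap.norm_compContinuousLinearMap_le _ _).trans ?_
  simp only [Finset.prod_const, Finset.card_univ, Fintype.card_fin]
  gcongr

open scoped ContDiff in
lemma aux_compact {G : Type*} [NormedAddCommGroup G] [NormedSpace ℝ G] (F : G → ℂ) (U : Set G)
    (hU : IsOpen U) (hF : ContDiffOn ℝ ∞ F U) (K : Set G) (hK : IsCompact K) (hKU : K ⊆ U)
    (k : ℕ) : ∃ C : ℝ, 0 < C ∧ ∀ x ∈ K, ‖iteratedFDeriv ℝ k F x‖ ≤ C := by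
  have hc : ContinuousOn (iteratedFDeriv ℝ k F) K := fun x hx =>
    ((hF.contDiffAt (hU.mem_nhds (hKU hx))).continuousAt_iteratedFDeriv
      (by exact_mod_cast le_top)).continuousWithinAt
  obtain ⟨C, hC⟩ := hK.exists_bound_of_continuousOn hc
  exact ⟨max C 1, by positivity, fun x hx => (hC x hx).trans (le_max_left _ _)⟩

lemma aux_cpow (r : ℝ) (hr : 0 < r) (z s : ℂ) (hs : s ≠ 0) :
    ((r : ℂ) * z) ^ s = (r : ℂ) ^ s * z ^ s := by
  rcases eq_or_ne z 0 with rfl | hz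
  · simp [hs]
  have hr' : (r : ℂ) ≠ 0 := by exact_mod_cast hr.ne'
  rw [Complex.cpow_def_of_ne_zero (mul_ne_zero hr' hz), Complex.cpow_def_of_ne_zero hr',
    Complex.cpow_def_of_ne_zero hz, Complex.log_ofReal_mul hr hz, add_mul, Complex.exp_add,
    Complex.ofReal_log hr.le]

lemma aux_smooth_cpow {G : Type*} [NormedAddCommGroup G] [NormedSpace ℝ G] (f : G → ℂ) (x : G)
    (hf : ContDiffAt ℝ (⊤ : ℕ∞) f x) (hx : f x ∈ Complex.slitPlane) (s : ℂ) :
    ContDiffAt ℝ (⊤ : ℕ∞) (fun y => f y ^ s) x := by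
  have h : ContDiffAt ℂ (⊤ : ℕ∞) (fun z : ℂ => z ^ s) (f x) :=
    (analyticAt_id.cpow analyticAt_const hx).contDiffAt
  exact (h.restrict_scalars ℝ).comp x hf

lemma aux_homog {n m : ℕ} (P : MvPolynomial (Fin n) ℝ) (hhom : P.IsHomogeneous m)
    (r : ℝ) (v : Fin n → ℝ) :
    MvPolynomial.eval (fun i => r * v i) P = r ^ m * MvPolynomial.eval v P := by
  rw [MvPolynomial.eval_eq, MvPolynomial.eval_eq, Finset.mul_sum]
  refine Finset.sum_congr rfl fun d hd => ?_
  have hdm : ∑ i ∈ d.support, d i = m := by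
    have := hhom (MvPolynomial.mem_support_iff.1 hd)
    rw [← this, Finsupp.weight_apply]
    simp [Finsupp.sum]
  simp only [mul_pow, Finset.prod_mul_distrib, Finset.prod_pow_eq_pow_sum, hdm]
  ring

/-- Symbol estimates, uniform in `ε`, for
`a_ε(ξ) = (1 − ψ(P(ξ)^{1/m})) (P(ξ) − (1+iε)^m)^{−α}`: all derivatives of order `k`
are `O((1+|ξ|)^{−mα−k})`. -/
theorem statement5
    (n m : ℕ) (hn : 2 ≤ n) (hm : 2 ≤ m)
    (P : MvPolynomial (Fin n) ℝ) (hhom : P.IsHomogeneous m)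
    (Pf : EuclideanSpace ℝ (Fin n) → ℝ)
    (hPf : ∀ ξ, Pf ξ = MvPolynomial.eval (fun i => ξ i) P)
    (hell : ∀ ξ : EuclideanSpace ℝ (Fin n), ξ ≠ 0 → 0 < Pf ξ)
    (hnd : ∀ ξ : EuclideanSpace ℝ (Fin n), ξ ≠ 0 → HessDet Pf ξ ≠ 0)
    (ψ : ℝ → ℝ) (hψ : ContDiff ℝ (⊤ : ℕ∞) ψ) (hψc : HasCompactSupport ψ)
    (hψ1 : ∀ s ∈ Set.Icc (-2 : ℝ) 2, ψ s = 1)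
    (hψs : tsupport ψ ⊆ Set.Icc (-4 : ℝ) 4)
    (α : ℝ) (hα : 0 < α) (k : ℕ) :
    ∃ C : ℝ, 0 < C ∧ ∀ ε : ℝ, ε ∈ Set.Ioc (0 : ℝ) 1 →
      (m : ℝ) * Real.arctan ε < Real.pi →
      ∀ ξ : EuclideanSpace ℝ (Fin n),
        ‖iteratedFDeriv ℝ k
            (fun ζ : EuclideanSpace ℝ (Fin n) =>
              ((1 - ψ (Pf ζ ^ ((1 : ℝ)/m)) : ℝ) : ℂ) *
                ((Pf ζ : ℂ) - (1 + ε * Complex.I) ^ m) ^ (-(α : ℂ))) ξ‖ ≤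
          C * (1 + ‖ξ‖) ^ (-((m : ℝ) * α) - k) := by
  have hPs : ContDiff ℝ (⊤ : ℕ∞) Pf := by
    have : Pf = fun ξ => ∑ d ∈ P.support, P.coeff d * ∏ i ∈ d.support, (ξ i) ^ d i := by
      funext ξ; rw [hPf, MvPolynomial.eval_eq]
    rw [this]
    fun_prop
  have hPh : ∀ (r : ℝ) ξ, Pf (r • ξ) = r ^ m * Pf ξ := by
    intro r ξ
    rw [hPf, hPf, ← aux_homog P hhom]
    rfl
  have hm0 : m ≠ 0 := by omega
  have hmR : (m : ℝ) ≠ 0 := by exact_mod_cast hm0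
  have hP0 : ∀ ξ, 0 ≤ Pf ξ := by
    intro ξ
    rcases eq_or_ne ξ 0 with rfl | h
    · have := hPh 0 0
      simp [hm0] at this
      exact this.ge
    · exact (hell ξ h).le
  obtain ⟨c, hc0, hc⟩ : ∃ c : ℝ, 0 < c ∧ ∀ ξ, ‖ξ‖ = 1 → c ≤ Pf ξ := by
    rcases (Metric.sphere (0 : EuclideanSpace ℝ (Fin n)) 1).eq_empty_or_nonempty with h | h
    · refine ⟨1, one_pos, fun ξ hξ => ?_⟩
      have : ξ ∈ Metric.sphere (0 : EuclideanSpace ℝ (Fin n)) 1 := by simpa using hξ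
      rw [h] at this
      exact this.elim
    · obtain ⟨x, hx, hmin⟩ := (isCompact_sphere _ _).exists_isMinOn h hPs.continuous.continuousOn
      refine ⟨Pf x, hell x ?_, fun ξ hξ => hmin (by simpa using hξ)⟩
      rintro rfl
      simp at hx
  have hlow : ∀ ξ, ξ ≠ 0 → c * ‖ξ‖ ^ m ≤ Pf ξ := by
    intro ξ h
    have h0 : ‖ξ‖ ≠ 0 := norm_ne_zero_iff.2 h
    have h1 : ξ = ‖ξ‖ • (‖ξ‖⁻¹ • ξ) := by rw [smul_smul, mul_inv_cancel₀ h0, one_smul]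
    have h2 : c ≤ Pf (‖ξ‖⁻¹ • ξ) := hc _ (by rw [norm_smul, norm_inv, norm_norm, inv_mul_cancel₀ h0])
    have h3 : Pf ξ = ‖ξ‖ ^ m * Pf (‖ξ‖⁻¹ • ξ) := by rw [← hPh, ← h1]
    rw [h3, mul_comm]
    gcongr
  -- roots of `Pf`
  have hroot : ∀ (t : ℝ) (ξ : EuclideanSpace ℝ (Fin n)), 0 ≤ t → Pf ξ < t ^ m →
      Pf ξ ^ ((1 : ℝ)/m) < t := by
    intro t ξ ht h
    rw [one_div, Real.rpow_inv_lt_iff_of_pos (hP0 ξ) ht (by positivity), Real.rpow_natCast]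
    exact h
  have hroot' : ∀ (t : ℝ) (ξ : EuclideanSpace ℝ (Fin n)), 0 ≤ t → t ^ m < Pf ξ →
      t < Pf ξ ^ ((1 : ℝ)/m) := by
    intro t ξ ht h
    rw [one_div, Real.lt_rpow_inv_iff_of_pos ht (hP0 ξ) (by positivity), Real.rpow_natCast]
    exact h
  set R : ℝ := max 1 (4 ^ m / c) with hR
  have hR1 : 1 ≤ R := le_max_left _ _
  have hbig : ∀ ξ : EuclideanSpace ℝ (Fin n), R < ‖ξ‖ → 4 ^ m < c * ‖ξ‖ ^ m := by
    intro ξ h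
    have h1 : 4 ^ m / c < ‖ξ‖ := (le_max_right _ _).trans_lt h
    have h2 : ‖ξ‖ ≤ ‖ξ‖ ^ m := le_self_pow₀ (hR1.trans h.le) hm0
    rw [div_lt_iff₀ hc0] at h1
    nlinarith
  -- the two model functions
  set G : EuclideanSpace ℝ (Fin n) × ℂ → ℂ := fun p => ((Pf p.1 : ℂ) - p.2) ^ (-(α : ℂ)) with hG
  set F : EuclideanSpace ℝ (Fin n) × ℂ → ℂ := fun p =>
    ((1 - ψ (Pf p.1 ^ ((1 : ℝ)/m)) : ℝ) : ℂ) * ((Pf p.1 : ℂ) - p.2) ^ (-(α : ℂ)) with hF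
  have hofR : ContDiff ℝ (⊤ : ℕ∞) (fun x : ℝ => (x : ℂ)) := Complex.ofRealCLM.contDiff
  have hbase : ContDiff ℝ (⊤ : ℕ∞)
      (fun p : EuclideanSpace ℝ (Fin n) × ℂ => (Pf p.1 : ℂ) - p.2) :=
    (hofR.comp (hPs.comp contDiff_fst)).sub contDiff_snd
  set UG : Set (EuclideanSpace ℝ (Fin n) × ℂ) := {p | 0 < ((Pf p.1 : ℂ) - p.2).re} with hUG
  have hUGo : IsOpen UG :=
    isOpen_lt continuous_const (Complex.continuous_re.comp hbase.continuous)
  have hGs : ∀ p ∈ UG, ContDiffAt ℝ (⊤ : ℕ∞) G p := fun p hp =>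
    aux_smooth_cpow _ p hbase.contDiffAt (Or.inl hp) _
  set UF : Set (EuclideanSpace ℝ (Fin n) × ℂ) := {p | ‖p.2‖ < 2 ^ m} with hUF
  have hUFo : IsOpen UF := isOpen_lt (by fun_prop) continuous_const
  have hFs : ∀ p ∈ UF, ContDiffAt ℝ (⊤ : ℕ∞) F p := by
    intro p hp
    rcases lt_or_ge (Pf p.1) (2 ^ m) with h | h
    · have hev : F =ᶠ[nhds p] fun _ => 0 := by
        have ho : IsOpen {q : EuclideanSpace ℝ (Fin n) × ℂ | Pf q.1 < 2 ^ m} :=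
          isOpen_lt (hPs.continuous.comp continuous_fst) continuous_const
        filter_upwards [ho.mem_nhds h] with q hq
        have h1 := hroot 2 q.1 (by norm_num) hq
        have h2 : 0 ≤ Pf q.1 ^ ((1 : ℝ)/m) := Real.rpow_nonneg (hP0 _) _
        simp only [hF]
        rw [hψ1 _ ⟨by linarith, h1.le⟩]
        simp
      exact contDiffAt_const.congr_of_eventuallyEq hev
    · have hpG : p ∈ UG := by
        have h1 : p.2.re ≤ ‖p.2‖ := Complex.re_le_norm _
        have h2 : ‖p.2‖ < 2 ^ m := hp
        simp only [hUG, Set.mem_setOf_eq, Complex.sub_re, Complex.ofReal_re]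
        linarith
      have h0 : Pf p.1 ≠ 0 := by have : (0:ℝ) < 2 ^ m := by positivity
                                 linarith
      have h1 : ContDiffAt ℝ (⊤ : ℕ∞) (fun q : EuclideanSpace ℝ (Fin n) × ℂ =>
          Pf q.1 ^ ((1 : ℝ)/m)) p :=
        ContDiffAt.rpow_const_of_ne (hPs.comp contDiff_fst).contDiffAt h0
      have h2 : ContDiffAt ℝ (⊤ : ℕ∞) (fun q : EuclideanSpace ℝ (Fin n) × ℂ =>
          ((1 - ψ (Pf q.1 ^ ((1 : ℝ)/m)) : ℝ) : ℂ)) p :=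
        hofR.contDiffAt.comp p (contDiffAt_const.sub (hψ.contDiffAt.comp p h1))
      exact h2.mul (hGs p hpG)
  obtain ⟨C₁, hC₁, hb₁⟩ := aux_compact F UF hUFo (fun p hp => (hFs p hp).contDiffWithinAt)
    (Metric.closedBall 0 R ×ˢ Metric.closedBall 0 ((3/2) ^ m))
    ((isCompact_closedBall _ _).prod (isCompact_closedBall _ _)) (by
      rintro p ⟨-, hp⟩
      have h1 : ‖p.2‖ ≤ (3/2) ^ m := by simpa using hp
      exact h1.trans_lt (pow_lt_pow_left₀ (by norm_num) (by norm_num) hm0)) k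
  obtain ⟨C₂, hC₂, hb₂⟩ := aux_compact G UG hUGo (fun p hp => (hGs p hp).contDiffWithinAt)
    (Metric.sphere 0 1 ×ˢ Metric.closedBall 0 (c / 2))
    ((isCompact_sphere _ _).prod (isCompact_closedBall _ _)) (by
      rintro p ⟨hp1, hp⟩
      have h1 : ‖p.2‖ ≤ c / 2 := by simpa using hp
      have h2 : p.2.re ≤ ‖p.2‖ := Complex.re_le_norm _
      have h3 := hc p.1 (by simpa using hp1)
      simp only [hUG, Set.mem_setOf_eq, Complex.sub_re, Complex.ofReal_re]
      linarith) k
  have hinl : ‖ContinuousLinearMap.inl ℝ (EuclideanSpace ℝ (Fin n)) ℂ‖ ≤ 1 :=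
    ContinuousLinearMap.opNorm_le_bound _ zero_le_one (fun x => by simp [Prod.norm_def])
  set s : ℝ := (m : ℝ) * α + k with hs
  have hs0 : 0 ≤ s := by positivity
  have hss : -((m : ℝ) * α) - k = -s := by rw [hs]; ring
  refine ⟨C₁ * (1 + R) ^ s + C₂ * 2 ^ s, by positivity, ?_⟩
  intro ε hε _ ξ
  rw [hss]
  set w : ℂ := (1 + ε * Complex.I) ^ m with hw
  have hwn : ‖w‖ ≤ (3/2) ^ m := by
    rw [hw, norm_pow]
    refine pow_le_pow_left₀ (norm_nonneg _) ?_ _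
    have h1 : ‖(1 + ε * Complex.I : ℂ)‖ ^ 2 = 1 + ε ^ 2 := by
      rw [Complex.sq_norm, Complex.normSq_apply]
      simp
      ring
    have h2 := hε.1
    have h3 := hε.2
    nlinarith [norm_nonneg (1 + ε * Complex.I : ℂ)]
  have hpos1 : 0 < 1 + ‖ξ‖ := by positivity
  rcases le_or_gt ‖ξ‖ R with hξ | hξ
  · have hmem : ContinuousLinearMap.inl ℝ (EuclideanSpace ℝ (Fin n)) ℂ ξ + (0, w) = (ξ, w) := by
      simp
    have hK : (ξ, w) ∈ (Metric.closedBall 0 R ×ˢ Metric.closedBall 0 ((3/2) ^ m) :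
        Set (EuclideanSpace ℝ (Fin n) × ℂ)) := ⟨by simpa using hξ, by simpa using hwn⟩
    have hU : (ξ, w) ∈ UF := hwn.trans_lt (pow_lt_pow_left₀ (by norm_num) (by norm_num) hm0)
    have h1 := aux_affine F UF hUFo (fun p hp => (hFs p hp).contDiffWithinAt)
      (ContinuousLinearMap.inl ℝ (EuclideanSpace ℝ (Fin n)) ℂ) (0, w) 1 hinl k ξ
      (by rw [hmem]; exact hU)
    rw [hmem, one_pow, mul_one] at h1
    have h2 : (fun y => F (ContinuousLinearMap.inl ℝ (EuclideanSpace ℝ (Fin n)) ℂ y + (0, w))) =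
        fun ζ => ((1 - ψ (Pf ζ ^ ((1 : ℝ)/m)) : ℝ) : ℂ) * ((Pf ζ : ℂ) - w) ^ (-(α : ℂ)) := by
      funext ζ
      simp [hF]
    rw [h2] at h1
    refine h1.trans ((hb₁ _ hK).trans ?_)
    have h3 : (1 + R) ^ (-s) ≤ (1 + ‖ξ‖) ^ (-s) :=
      Real.rpow_le_rpow_of_nonpos hpos1 (by linarith) (by linarith)
    have h4 : (1 + R) ^ s * (1 + R) ^ (-s) = 1 := by
      rw [← Real.rpow_add (by positivity)]; simp
    calc C₁ = C₁ * ((1 + R) ^ s * (1 + R) ^ (-s)) := by rw [h4, mul_one]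
      _ ≤ C₁ * ((1 + R) ^ s * (1 + ‖ξ‖) ^ (-s)) := by gcongr
      _ = C₁ * (1 + R) ^ s * (1 + ‖ξ‖) ^ (-s) := by ring
      _ ≤ _ := by
        gcongr
        have : 0 ≤ C₂ * (2:ℝ) ^ s := by positivity
        linarith
  · set r : ℝ := ‖ξ‖ with hr
    have hr0 : 0 < r := by linarith
    have hξ0 : ξ ≠ 0 := norm_pos_iff.1 hr0
    have hrm : 0 < r ^ m := by positivity
    set b : ℂ := (((r ^ m)⁻¹ : ℝ) : ℂ) * w with hb
    set L : EuclideanSpace ℝ (Fin n) →L[ℝ] EuclideanSpace ℝ (Fin n) × ℂ :=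
      r⁻¹ • ContinuousLinearMap.inl ℝ (EuclideanSpace ℝ (Fin n)) ℂ with hLdef
    have hL : ‖L‖ ≤ r⁻¹ := by
      rw [hLdef, norm_smul, Real.norm_of_nonneg (by positivity)]
      exact mul_le_of_le_one_right (by positivity) hinl
    have hmem : ∀ ζ, L ζ + (0, b) = (r⁻¹ • ζ, b) := by intro ζ; simp [hLdef]
    have hbn : ‖b‖ ≤ c / 2 := by
      rw [hb, norm_mul, Complex.norm_real, Real.norm_of_nonneg (by positivity),
        inv_mul_le_iff₀ hrm]
      have h1 := hbig ξ hξ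
      have h2 : (2:ℝ) * (3/2) ^ m ≤ 4 ^ m := by
        have h3 : (4:ℝ) ^ m = (8/3) ^ m * (3/2) ^ m := by rw [← mul_pow]; norm_num
        have h4 : (8/3:ℝ) ≤ (8/3) ^ m := le_self_pow₀ (by norm_num) hm0
        rw [h3]
        gcongr
        linarith
      linarith
    have hK : (r⁻¹ • ξ, b) ∈ (Metric.sphere 0 1 ×ˢ Metric.closedBall 0 (c / 2) :
        Set (EuclideanSpace ℝ (Fin n) × ℂ)) := by
      refine ⟨?_, by simpa using hbn⟩
      simp only [mem_sphere_zero_iff_norm, norm_smul, norm_inv, Real.norm_of_nonneg hr0.le]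
      exact inv_mul_cancel₀ hr0.ne'
    have hU : (r⁻¹ • ξ, b) ∈ UG := by
      have h2 : b.re ≤ ‖b‖ := Complex.re_le_norm _
      have h3 := hc (r⁻¹ • ξ) (by simpa using hK.1)
      simp only [hUG, Set.mem_setOf_eq, Complex.sub_re, Complex.ofReal_re]
      linarith
    have h1 := aux_affine G UG hUGo (fun p hp => (hGs p hp).contDiffWithinAt) L (0, b) r⁻¹ hL k ξ
      (by rw [hmem]; exact hU)
    rw [hmem] at h1
    have hα0 : (-(α : ℂ)) ≠ 0 := by simpa using hα.ne'
    have hev : (fun ζ => ((1 - ψ (Pf ζ ^ ((1 : ℝ)/m)) : ℝ) : ℂ) * ((Pf ζ : ℂ) - w) ^ (-(α : ℂ)))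
        =ᶠ[nhds ξ] (((r ^ m) ^ (-α) : ℝ) • fun ζ => G (L ζ + (0, b))) := by
      have ho : IsOpen {ζ : EuclideanSpace ℝ (Fin n) | R < ‖ζ‖} :=
        isOpen_lt continuous_const continuous_norm
      filter_upwards [ho.mem_nhds hξ] with ζ hζ
      have hζ0 : ζ ≠ 0 := norm_pos_iff.1 (by have : R < ‖ζ‖ := hζ
                                             linarith)
      have h4 := hroot' 4 ζ (by norm_num) ((hbig ζ hζ).trans_le (hlow ζ hζ0))
      have h5 : ψ (Pf ζ ^ ((1 : ℝ)/m)) = 0 := by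
        apply image_eq_zero_of_notMem_tsupport
        intro hmm
        have := (hψs hmm).2
        linarith
      have h6 : (Pf ζ : ℂ) - w = ((r ^ m : ℝ) : ℂ) * ((Pf (r⁻¹ • ζ) : ℂ) - b) := by
        rw [hPh, hb, mul_sub, ← mul_assoc, ← Complex.ofReal_mul, ← Complex.ofReal_mul, ← mul_assoc,
          mul_inv_cancel₀ hrm.ne', inv_pow, mul_inv_cancel₀ hrm.ne']
        simp
      simp only [Pi.smul_apply, hmem, hG]
      rw [h5, h6, aux_cpow _ hrm _ _ hα0, Complex.real_smul, Complex.ofReal_cpow hrm.le]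
      simp
    have hcd : ContDiffAt ℝ k (fun ζ => G (L ζ + (0, b))) ξ := by
      have h7 : ContDiffAt ℝ (⊤ : ℕ∞) (fun ζ => G (L ζ + (0, b))) ξ := by
        have h8 : ContDiffAt ℝ (⊤ : ℕ∞) G (L ξ + (0, b)) := by rw [hmem]; exact hGs _ hU
        exact h8.comp ξ (L.contDiff.add contDiff_const).contDiffAt
      exact h7.of_le (by exact_mod_cast le_top)
    rw [(hev.iteratedFDeriv (𝕜 := ℝ) k).self_of_nhds, iteratedFDeriv_const_smul_apply hcd,
      norm_smul, Real.norm_of_nonneg (by positivity)]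
    have h9 : (r ^ m) ^ (-α) * (r⁻¹) ^ k = r ^ (-s) := by
      rw [← Real.rpow_natCast r m, ← Real.rpow_mul hr0.le, inv_pow, ← Real.rpow_natCast r k,
        ← Real.rpow_neg hr0.le, ← Real.rpow_add hr0, hs]
      congr 1
      ring
    have h10 : r ^ (-s) ≤ 2 ^ s * (1 + r) ^ (-s) := by
      have h11 : (2 * r) ^ (-s) ≤ (1 + r) ^ (-s) :=
        Real.rpow_le_rpow_of_nonpos hpos1 (by linarith) (by linarith)
      rw [Real.mul_rpow (by norm_num) hr0.le] at h11
      have h12 : (2:ℝ) ^ s * 2 ^ (-s) = 1 := by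
        rw [← Real.rpow_add (by positivity)]; simp
      calc r ^ (-s) = 2 ^ s * (2 ^ (-s) * r ^ (-s)) := by rw [← mul_assoc, h12, one_mul]
        _ ≤ _ := by gcongr
    calc _ ≤ (r ^ m) ^ (-α) * (C₂ * (r⁻¹) ^ k) := by
            gcongr
            exact h1.trans (by gcongr; exact hb₂ _ hK)
      _ = C₂ * ((r ^ m) ^ (-α) * (r⁻¹) ^ k) := by ring
      _ ≤ C₂ * (2 ^ s * (1 + r) ^ (-s)) := by rw [h9]; gcongr
      _ = C₂ * 2 ^ s * (1 + r) ^ (-s) := by ring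
      _ ≤ _ := by
        gcongr
        have : 0 ≤ C₁ * (1 + R) ^ s := by positivity
        linarith
end
end

section
/- Let ψ ∈ C_c^∞(ℝ) satisfy ψ ≡ 1 on [−2,2] and supp ψ ⊆ [−4,4], let α > 0 with mα < n, and for ε ∈ (0,1] with m·arctan(ε) < π set a_ε(ξ) = (1 − ψ(P(ξ)^{1/m})) · (P(ξ) − (1+iε)^m)^{−α}. Let 1 ≤ p ≤ q ≤ ∞ satisfy 0 ≤ 1/p − 1/q ≤ mα/n with (p,q) ≠ (n/(mα), ∞) and (p,q) ≠ (1, n/(n − mα)). Then there is a constant C, independent of ε, such that for every Schwartz function f, ‖𝓕⁻¹(a_ε · f̂)‖_{L^q} ≤ C ‖f‖_{L^p}. -/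
open MeasureTheory Complex
open scoped ENNReal RealInnerProductSpace

noncomputable section

theorem aux_lint_near {n : ℕ} (hn : 2 ≤ n) {μ : ℝ} (hμ : μ < n) :
    ∃ c : ℝ, 0 < c ∧ ∀ R : ℝ, 0 < R →
      ∫⁻ x in Metric.ball (0 : EuclideanSpace ℝ (Fin n)) R, ENNReal.ofReal (‖x‖ ^ (-μ)) ≤
        ENNReal.ofReal (c * R ^ ((n : ℝ) - μ)) := by
  have : Nonempty (Fin n) := ⟨⟨0, by omega⟩⟩
  set V : ℝ := (volume : Measure (EuclideanSpace ℝ (Fin n))).real (Metric.ball 0 1) with hV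
  have hVpos : 0 ≤ V := measureReal_nonneg
  refine ⟨n * V * (1 / ((n : ℝ) - μ)) + 1, by
    have : 0 < (n : ℝ) - μ := by linarith
    positivity, fun R hR => ?_⟩
  have hpos : 0 < (n : ℝ) - μ := by linarith
  have key : ∀ y ∈ Set.Ioo (0 : ℝ) R, y ^ (Module.finrank ℝ (EuclideanSpace ℝ (Fin n)) - 1) • y ^ (-μ)
      = y ^ ((n : ℝ) - 1 - μ) := by
    intro y hy
    rw [finrank_euclideanSpace_fin, smul_eq_mul, ← Real.rpow_natCast, ← Real.rpow_add hy.1]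
    congr 1
    rw [Nat.cast_sub (by omega)]; push_cast; ring
  have hInt1 : IntegrableOn (fun y : ℝ => y ^ ((n : ℝ) - 1 - μ)) (Set.Ioo 0 R) := by
    rw [intervalIntegral.integrableOn_Ioo_rpow_iff hR]; linarith
  have hInt : IntegrableOn (fun x : EuclideanSpace ℝ (Fin n) => ‖x‖ ^ (-μ)) (Metric.ball 0 R) := by
    rw [integrableOn_fun_norm_addHaar volume (f := fun y : ℝ => y ^ (-μ)),
      integrableOn_congr_fun key measurableSet_Ioo]
    exact hInt1
  rw [← ofReal_integral_eq_lintegral_ofReal hInt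
    (Filter.Eventually.of_forall fun x => Real.rpow_nonneg (norm_nonneg x) _)]
  apply ENNReal.ofReal_le_ofReal
  have e1 : ∫ x in Metric.ball (0 : EuclideanSpace ℝ (Fin n)) R, ‖x‖ ^ (-μ) =
      ∫ x : EuclideanSpace ℝ (Fin n), (Set.Iio R).indicator (fun y : ℝ => y ^ (-μ)) ‖x‖ := by
    rw [← integral_indicator measurableSet_ball]
    congr 1; ext x
    simp [Set.indicator]
  rw [e1, integral_fun_norm_addHaar volume (fun y => (Set.Iio R).indicator (fun y : ℝ => y ^ (-μ)) y)]
  have e2 : ∫ y in Set.Ioi (0 : ℝ), y ^ (Module.finrank ℝ (EuclideanSpace ℝ (Fin n)) - 1) •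
      (Set.Iio R).indicator (fun y : ℝ => y ^ (-μ)) y = R ^ ((n : ℝ) - μ) / ((n : ℝ) - μ) := by
    have : ∫ y in Set.Ioi (0 : ℝ), y ^ (Module.finrank ℝ (EuclideanSpace ℝ (Fin n)) - 1) •
      (Set.Iio R).indicator (fun y : ℝ => y ^ (-μ)) y =
      ∫ y in Set.Ioi (0 : ℝ), (Set.Iio R).indicator (fun y : ℝ => y ^ ((n : ℝ) - 1 - μ)) y := by
      apply setIntegral_congr_fun measurableSet_Ioi
      intro y hy
      by_cases h : y < R
      · simpa [Set.indicator, h] using key y ⟨hy, h⟩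
      · simp [Set.indicator, h]
    rw [this, setIntegral_indicator measurableSet_Iio, Set.Ioi_inter_Iio, ← integral_Ioc_eq_integral_Ioo,
      ← intervalIntegral.integral_of_le hR.le, integral_rpow (Or.inl (by linarith))]
    rw [show (n : ℝ) - 1 - μ + 1 = n - μ by ring, Real.zero_rpow hpos.ne', sub_zero]
  rw [e2, finrank_euclideanSpace_fin, ← hV]
  simp only [smul_eq_mul, nsmul_eq_mul]
  have : 0 < R ^ ((n : ℝ) - μ) := Real.rpow_pos_of_pos hR _
  rw [add_mul, div_eq_mul_one_div]
  nlinarith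

theorem aux_lint_far {n : ℕ} (hn : 2 ≤ n) {μ : ℝ} (hμ : n < μ) :
    ∃ c : ℝ, 0 < c ∧ ∀ R : ℝ, 0 < R →
      ∫⁻ x in (Metric.ball (0 : EuclideanSpace ℝ (Fin n)) R)ᶜ, ENNReal.ofReal (‖x‖ ^ (-μ)) ≤
        ENNReal.ofReal (c * R ^ ((n : ℝ) - μ)) := by
  have : Nonempty (Fin n) := ⟨⟨0, by omega⟩⟩
  set V : ℝ := (volume : Measure (EuclideanSpace ℝ (Fin n))).real (Metric.ball 0 1) with hV
  have hVpos : 0 ≤ V := measureReal_nonneg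
  have hpos : 0 < μ - (n : ℝ) := by linarith
  refine ⟨n * V * (1 / (μ - n)) + 1, by positivity, fun R hR => ?_⟩
  have key : ∀ y ∈ Set.Ioi (0 : ℝ), y ^ (Module.finrank ℝ (EuclideanSpace ℝ (Fin n)) - 1) •
      (Set.Ici R).indicator (fun y : ℝ => y ^ (-μ)) y
      = (Set.Ici R).indicator (fun y : ℝ => y ^ ((n : ℝ) - 1 - μ)) y := by
    intro y hy
    by_cases h : R ≤ y
    · simp only [Set.indicator, Set.mem_Ici, h, if_true]
      rw [finrank_euclideanSpace_fin, smul_eq_mul, ← Real.rpow_natCast, ← Real.rpow_add hy]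
      congr 1
      rw [Nat.cast_sub (by omega)]; push_cast; ring
    · simp [Set.indicator, h]
  have hsub : Set.Ici R ⊆ Set.Ioi (0:ℝ) := fun y hy => lt_of_lt_of_le hR hy
  have hInt1 : IntegrableOn ((Set.Ici R).indicator fun y : ℝ => y ^ ((n : ℝ) - 1 - μ)) (Set.Ioi 0) := by
    apply Integrable.integrableOn
    rw [integrable_indicator_iff measurableSet_Ici, integrableOn_Ici_iff_integrableOn_Ioi]
    exact integrableOn_Ioi_rpow_of_lt (by linarith) hR
  have hind : ∀ x : EuclideanSpace ℝ (Fin n), (Metric.ball (0 : EuclideanSpace ℝ (Fin n)) R)ᶜ.indicator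
      (fun x => ‖x‖ ^ (-μ)) x = (Set.Ici R).indicator (fun y : ℝ => y ^ (-μ)) ‖x‖ := by
    intro x; simp [Set.indicator]
  have hInt : IntegrableOn (fun x : EuclideanSpace ℝ (Fin n) => ‖x‖ ^ (-μ)) (Metric.ball 0 R)ᶜ := by
    rw [← integrable_indicator_iff measurableSet_ball.compl]
    rw [show (Metric.ball (0 : EuclideanSpace ℝ (Fin n)) R)ᶜ.indicator
      (fun x => ‖x‖ ^ (-μ)) = fun x => (Set.Ici R).indicator (fun y : ℝ => y ^ (-μ)) ‖x‖ from funext hind]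
    rw [integrable_fun_norm_addHaar volume (f := (Set.Ici R).indicator (fun y : ℝ => y ^ (-μ))),
      integrableOn_congr_fun key measurableSet_Ioi]
    exact hInt1
  rw [← ofReal_integral_eq_lintegral_ofReal hInt
    (Filter.Eventually.of_forall fun x => Real.rpow_nonneg (norm_nonneg x) _)]
  apply ENNReal.ofReal_le_ofReal
  rw [← integral_indicator measurableSet_ball.compl, integral_congr_ae (Filter.Eventually.of_forall hind),
    integral_fun_norm_addHaar volume (fun y => (Set.Ici R).indicator (fun y : ℝ => y ^ (-μ)) y),
    setIntegral_congr_fun measurableSet_Ioi key, setIntegral_indicator measurableSet_Ici,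
    Set.inter_eq_right.2 hsub, integral_Ici_eq_integral_Ioi, integral_Ioi_rpow_of_lt (by linarith) hR,
    finrank_euclideanSpace_fin, ← hV]
  simp only [smul_eq_mul, nsmul_eq_mul]
  rw [show (n : ℝ) - 1 - μ + 1 = n - μ by ring]
  have : 0 < R ^ ((n : ℝ) - μ) := Real.rpow_pos_of_pos hR _
  have h3 : -R ^ ((n : ℝ) - μ) / (n - μ) = R ^ ((n : ℝ) - μ) * (1 / (μ - n)) := by
    rw [← neg_sub μ (n : ℝ), neg_div_neg_eq]; ring
  rw [h3]
  nlinarith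
theorem aux_conv_L1 {n : ℕ} {κ g : EuclideanSpace ℝ (Fin n) → ℝ≥0∞} (hκ : Measurable κ)
    (hg : Measurable g) :
    ∫⁻ x, ∫⁻ y, κ (x - y) * g y = (∫⁻ x, κ x) * ∫⁻ y, g y := by
  rw [lintegral_lintegral_swap]
  · have : ∀ y, ∫⁻ x, κ (x - y) * g y = (∫⁻ x, κ x) * g y := by
      intro y
      rw [lintegral_mul_const _ (by fun_prop), lintegral_sub_right_eq_self κ y]
    simp_rw [this]
    rw [lintegral_const_mul _ hg]
  · apply Measurable.aemeasurable
    fun_prop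

theorem aux_HLS_level {n : ℕ} (hn : 2 ≤ n) {lam p q : ℝ} (hl : 0 < lam) (hl' : lam < n)
    (hp : 1 < p) (hq : 0 < q) (hrel : 1 / q = 1 / p - 1 + lam / n)
    {κ : EuclideanSpace ℝ (Fin n) → ℝ≥0∞} (hκm : Measurable κ) {A : ℝ} (hA : 0 < A)
    (hκ : ∀ x, κ x ≤ ENNReal.ofReal (A * ‖x‖ ^ (-lam))) :
    ∃ c C : ℝ, 0 < c ∧ 0 < C ∧ ∀ F : EuclideanSpace ℝ (Fin n) → ℝ≥0∞, Measurable F →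
      ∫⁻ x, F x ^ p ≤ 1 → ∀ h : ℝ, 0 < h →
      volume {x | ENNReal.ofReal (c * h ^ (p / q)) < ∫⁻ y, κ (x - y) * F y} ≤
        ENNReal.ofReal (C * h⁻¹) * ∫⁻ y in {y | ENNReal.ofReal h < F y}, F y := by
  have hn0 : (0 : ℝ) < n := by positivity
  have hp0 : 0 < p := by linarith
  set p' := p / (p - 1) with hp'
  have hp'0 : 0 < p' := div_pos hp0 (by linarith)
  have hconj : p'.HolderConjugate p := (Real.HolderConjugate.conjExponent hp).symm
  have hfar : (n : ℝ) < lam * p' := by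
    have h1 : 0 < 1 / p - 1 + lam / n := hrel ▸ (by positivity)
    have h2 : 0 < (1 / p - 1 + lam / n) * (n * p) := by positivity
    have h3 : (1 / p - 1 + lam / n) * (n * p) = n - n * p + lam * p := by
      field_simp
    rw [h3] at h2
    rw [hp', ← mul_div_assoc, lt_div_iff₀ (by linarith)]
    nlinarith
  obtain ⟨c1, hc1, H1⟩ := aux_lint_far hn hfar
  obtain ⟨c2, hc2, H2⟩ := aux_lint_near hn hl'
  set d1 : ℝ := A * c1 ^ (1 / p') with hd1
  set d2 : ℝ := A * c2 with hd2
  have hd1p : 0 < d1 := by positivity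
  have hd2p : 0 < d2 := by positivity
  refine ⟨2 * (d1 + d2), d2 / (d1 + d2), by positivity, by positivity, ?_⟩
  intro F hF hF1 h hh
  set R : ℝ := h ^ (-p / n) with hR
  have hRp : 0 < R := Real.rpow_pos_of_pos hh _
  set B : Set (EuclideanSpace ℝ (Fin n)) := Metric.ball 0 R with hB
  have hBm : MeasurableSet B := measurableSet_ball
  set S : Set (EuclideanSpace ℝ (Fin n)) := {y | ENNReal.ofReal h < F y} with hS
  have hSm : MeasurableSet S := measurableSet_lt measurable_const hF
  set κ1 := B.indicator κ with hκ1
  set κ2 := Bᶜ.indicator κ with hκ2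
  have hκ1m : Measurable κ1 := hκm.indicator hBm
  have hκ2m : Measurable κ2 := hκm.indicator hBm.compl
  have hκ1int : ∫⁻ x, κ1 x ≤ ENNReal.ofReal (d2 * R ^ ((n : ℝ) - lam)) := by
    rw [hκ1, lintegral_indicator hBm]
    calc ∫⁻ x in B, κ x ≤ ∫⁻ x in B, ENNReal.ofReal A * ENNReal.ofReal (‖x‖ ^ (-lam)) := by
          apply lintegral_mono; intro x
          dsimp only
          rw [← ENNReal.ofReal_mul hA.le]; exact hκ x
      _ = ENNReal.ofReal A * ∫⁻ x in B, ENNReal.ofReal (‖x‖ ^ (-lam)) := by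
          rw [lintegral_const_mul']; simp
      _ ≤ ENNReal.ofReal A * ENNReal.ofReal (c2 * R ^ ((n : ℝ) - lam)) := by
          gcongr; exact H2 R hRp
      _ = _ := by rw [← ENNReal.ofReal_mul hA.le, hd2, mul_assoc]
  have hRpow1 : R ^ ((n : ℝ) - lam) = h ^ (p / q - 1) := by
    rw [hR, ← Real.rpow_mul hh.le]
    congr 1
    have : p / q = p * (1 / q) := by ring
    rw [this, hrel]; field_simp; ring
  have hκ2int : (∫⁻ x, κ2 x ^ p') ^ (1 / p') ≤ ENNReal.ofReal (d1 * h ^ (p / q)) := by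
    have e1 : ∫⁻ x, κ2 x ^ p' = ∫⁻ x in Bᶜ, κ x ^ p' := by
      rw [← lintegral_indicator hBm.compl]
      congr 1; ext x
      by_cases hx : x ∈ Bᶜ
      · simp only [hκ2, Set.indicator_of_mem hx]
      · simp only [hκ2, Set.indicator_of_notMem hx]
        exact ENNReal.zero_rpow_of_pos hp'0
    have e2 : ∫⁻ x in Bᶜ, κ x ^ p' ≤ ENNReal.ofReal (A ^ p' * (c1 * R ^ ((n : ℝ) - lam * p'))) := by
      calc ∫⁻ x in Bᶜ, κ x ^ p' ≤ ∫⁻ x in Bᶜ, ENNReal.ofReal (A ^ p') * ENNReal.ofReal (‖x‖ ^ (-(lam * p'))) := by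
            apply lintegral_mono; intro x
            calc κ x ^ p' ≤ (ENNReal.ofReal (A * ‖x‖ ^ (-lam))) ^ p' :=
                  ENNReal.rpow_le_rpow (hκ x) hp'0.le
              _ = _ := by
                  rw [ENNReal.ofReal_rpow_of_nonneg (by positivity) hp'0.le,
                    Real.mul_rpow hA.le (by positivity), ← Real.rpow_mul (norm_nonneg x),
                    ENNReal.ofReal_mul (by positivity), neg_mul]
        _ = ENNReal.ofReal (A ^ p') * ∫⁻ x in Bᶜ, ENNReal.ofReal (‖x‖ ^ (-(lam * p'))) := by
            rw [lintegral_const_mul']; simp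
        _ ≤ ENNReal.ofReal (A ^ p') * ENNReal.ofReal (c1 * R ^ ((n : ℝ) - lam * p')) := by
            gcongr; exact H1 R hRp
        _ = _ := by rw [← ENNReal.ofReal_mul (by positivity)]
    calc (∫⁻ x, κ2 x ^ p') ^ (1 / p') ≤
        (ENNReal.ofReal (A ^ p' * (c1 * R ^ ((n : ℝ) - lam * p')))) ^ (1 / p') := by
          rw [e1]; exact ENNReal.rpow_le_rpow e2 (by positivity)
      _ = _ := by
        rw [ENNReal.ofReal_rpow_of_nonneg (by positivity) (by positivity)]
        congr 1
        rw [Real.mul_rpow (by positivity) (by positivity), Real.mul_rpow (by positivity) (by positivity),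
          ← Real.rpow_mul hA.le, mul_one_div_cancel hp'0.ne', Real.rpow_one, hd1, mul_assoc,
          ← Real.rpow_mul hRp.le, hR, ← Real.rpow_mul hh.le]
        congr 3
        have e3 : p / q = p * (1 / q) := by ring
        rw [e3, hrel, hp']
        have : p - 1 ≠ 0 := by linarith
        field_simp
        ring
  have hsplit : ∀ x, ∫⁻ y, κ (x - y) * F y ≤ ENNReal.ofReal ((d1 + d2) * h ^ (p / q)) +
      ∫⁻ y, κ1 (x - y) * S.indicator F y := by
    intro x
    have s1 : ∫⁻ y, κ2 (x - y) * F y ≤ ENNReal.ofReal (d1 * h ^ (p / q)) := by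
      calc ∫⁻ y, κ2 (x - y) * F y ≤ (∫⁻ y, κ2 (x - y) ^ p') ^ (1 / p') * (∫⁻ y, F y ^ p) ^ (1 / p) :=
            ENNReal.lintegral_mul_le_Lp_mul_Lq volume hconj (by fun_prop) hF.aemeasurable
        _ ≤ (∫⁻ y, κ2 (x - y) ^ p') ^ (1 / p') * 1 := by
            gcongr
            calc (∫⁻ y, F y ^ p) ^ (1 / p) ≤ 1 ^ (1 / p) := ENNReal.rpow_le_rpow hF1 (by positivity)
              _ = 1 := ENNReal.one_rpow _
        _ = (∫⁻ y, κ2 y ^ p') ^ (1 / p') := by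
            rw [mul_one, lintegral_sub_left_eq_self (fun z => κ2 z ^ p') x]
        _ ≤ _ := hκ2int
    have s2 : ∫⁻ y, κ1 (x - y) * Sᶜ.indicator F y ≤ ENNReal.ofReal (d2 * h ^ (p / q)) := by
      calc ∫⁻ y, κ1 (x - y) * Sᶜ.indicator F y ≤ ∫⁻ y, κ1 (x - y) * ENNReal.ofReal h := by
            apply lintegral_mono; intro y
            dsimp only
            gcongr
            by_cases hy : y ∈ S
            · rw [Set.indicator_of_notMem (by simpa using hy)]; exact zero_le
            · rw [Set.indicator_of_mem (by simpa using hy)]; simpa [hS] using hy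
        _ = (∫⁻ y, κ1 y) * ENNReal.ofReal h := by
            rw [lintegral_mul_const _ (by fun_prop), lintegral_sub_left_eq_self κ1 x]
        _ ≤ ENNReal.ofReal (d2 * R ^ ((n : ℝ) - lam)) * ENNReal.ofReal h := by gcongr
        _ = _ := by
            rw [← ENNReal.ofReal_mul (by positivity), hRpow1, mul_assoc]
            congr 2
            nth_rewrite 2 [← Real.rpow_one h]
            rw [← Real.rpow_add hh]; congr 1; ring
    calc ∫⁻ y, κ (x - y) * F y = ∫⁻ y, (κ2 (x - y) * F y + κ1 (x - y) * Sᶜ.indicator F y) +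
          κ1 (x - y) * S.indicator F y := by
          congr 1; ext y
          have hk : κ (x - y) = κ1 (x - y) + κ2 (x - y) := by
            have := Set.indicator_self_add_compl B κ
            exact (congrFun this (x - y)).symm
          have hf : F y = Sᶜ.indicator F y + S.indicator F y := by
            have := Set.indicator_compl_add_self S F
            exact (congrFun this y).symm
          rw [add_assoc, ← mul_add, ← hf, ← add_mul, hk, add_comm]
      _ = ((∫⁻ y, κ2 (x - y) * F y) + ∫⁻ y, κ1 (x - y) * Sᶜ.indicator F y) +
          ∫⁻ y, κ1 (x - y) * S.indicator F y := by
          have m1 : Measurable (Sᶜ.indicator F) := hF.indicator hSm.compl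
          rw [lintegral_add_left (by fun_prop), lintegral_add_left (by fun_prop)]
      _ ≤ _ := by
          gcongr
          rw [add_mul, ENNReal.ofReal_add (by positivity) (by positivity)]
          exact add_le_add s1 s2
  have hSF : Measurable (S.indicator F) := hF.indicator hSm
  have hsub : {x | ENNReal.ofReal (2 * (d1 + d2) * h ^ (p / q)) < ∫⁻ y, κ (x - y) * F y} ⊆
      {x | ENNReal.ofReal ((d1 + d2) * h ^ (p / q)) ≤ ∫⁻ y, κ1 (x - y) * S.indicator F y} := by
    intro x hx
    simp only [Set.mem_ofPred_eq] at hx ⊢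
    by_contra hcon
    rw [not_le] at hcon
    have := hx.trans_le (hsplit x)
    rw [mul_assoc, two_mul, ENNReal.ofReal_add (by positivity) (by positivity)] at this
    have h2 := (ENNReal.add_lt_add_iff_left ENNReal.ofReal_ne_top).1 this
    exact absurd hcon (not_lt.2 h2.le)
  have hpos : 0 < (d1 + d2) * h ^ (p / q) := by positivity
  calc _ ≤ _ := measure_mono hsub
    _ ≤ (∫⁻ x, ∫⁻ y, κ1 (x - y) * S.indicator F y) / ENNReal.ofReal ((d1 + d2) * h ^ (p / q)) := by
      apply meas_ge_le_lintegral_div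
      · apply Measurable.aemeasurable
        apply Measurable.lintegral_prod_right'
          (f := fun z : EuclideanSpace ℝ (Fin n) × EuclideanSpace ℝ (Fin n) => κ1 (z.1 - z.2) * S.indicator F z.2)
        fun_prop
      · simpa using hpos
      · exact ENNReal.ofReal_ne_top
    _ ≤ (ENNReal.ofReal (d2 * R ^ ((n : ℝ) - lam)) * ∫⁻ y in S, F y) / ENNReal.ofReal ((d1 + d2) * h ^ (p / q)) := by
      rw [aux_conv_L1 hκ1m hSF, lintegral_indicator hSm]
      gcongr
    _ = _ := by
      rw [div_eq_mul_inv, mul_right_comm, ← ENNReal.ofReal_inv_of_pos hpos, ← ENNReal.ofReal_mul (by positivity), hRpow1]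
      congr 2
      rw [Real.rpow_sub hh, Real.rpow_one]
      field_simp

theorem aux_HLS {n : ℕ} (hn : 2 ≤ n) {lam p q : ℝ} (hl : 0 < lam) (hl' : lam < n)
    (hp : 1 < p) (hq : 0 < q) (hrel : 1 / q = 1 / p - 1 + lam / n)
    {κ : EuclideanSpace ℝ (Fin n) → ℝ≥0∞} (hκm : Measurable κ) {A : ℝ} (hA : 0 < A)
    (hκ : ∀ x, κ x ≤ ENNReal.ofReal (A * ‖x‖ ^ (-lam))) :
    ∃ C : ℝ, 0 < C ∧ ∀ F : EuclideanSpace ℝ (Fin n) → ℝ≥0∞, Measurable F → (∀ x, F x ≠ ∞) →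
      (∀ x, ∫⁻ y, κ (x - y) * F y ≠ ∞) →
      ∫⁻ x, F x ^ p ≤ 1 → ∫⁻ x, (∫⁻ y, κ (x - y) * F y) ^ q ≤ ENNReal.ofReal C := by
  obtain ⟨c, C, hc, hC, H⟩ := aux_HLS_level hn hl hl' hp hq hrel hκm hA hκ
  have hp0 : 0 < p := by linarith
  refine ⟨c ^ q * (p * C * (p - 1)⁻¹), by
    have : 0 < p - 1 := by linarith
    positivity, ?_⟩
  intro F hF hFt hG hF1
  set G : EuclideanSpace ℝ (Fin n) → ℝ≥0∞ := fun x => ∫⁻ y, κ (x - y) * F y with hGdef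
  have hGm : Measurable G := by
    apply Measurable.lintegral_prod_right'
          (f := fun z : EuclideanSpace ℝ (Fin n) × EuclideanSpace ℝ (Fin n) => κ (z.1 - z.2) * F z.2)
    fun_prop
  set T : EuclideanSpace ℝ (Fin n) → ℝ := fun x => ((G x).toReal / c) ^ (q / p) with hT
  have hTm : Measurable T := by
    have := hGm.ennreal_toReal
    fun_prop
  have hT0 : ∀ x, 0 ≤ T x := fun x => by positivity
  have h1 : ∀ x, G x ^ q = ENNReal.ofReal (c ^ q) * ENNReal.ofReal (T x ^ p) := by
    intro x
    rw [← ENNReal.ofReal_mul (by positivity), hT]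
    dsimp only
    rw [← Real.rpow_mul (by positivity), div_mul_cancel₀ _ hp0.ne',
      ← Real.mul_rpow hc.le (by positivity), mul_div_cancel₀ _ hc.ne',
      ← ENNReal.ofReal_rpow_of_nonneg (by positivity) hq.le, ENNReal.ofReal_toReal (hG x)]
  have h2 : ∀ h : ℝ, 0 < h → volume {x | h < T x} ≤
      ENNReal.ofReal (C * h⁻¹) * ∫⁻ y in {y | ENNReal.ofReal h < F y}, F y := by
    intro h hh
    refine le_trans (measure_mono ?_) (H F hF hF1 h hh)
    intro x hx
    simp only [Set.mem_ofPred_eq] at hx ⊢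
    rw [← ENNReal.ofReal_toReal (hG x)]
    rw [ENNReal.ofReal_lt_ofReal_iff_of_nonneg (by positivity)]
    have h3 : h ^ (p / q) < T x ^ (p / q) := Real.rpow_lt_rpow hh.le hx (by positivity)
    rw [hT] at h3
    dsimp only at h3
    rw [← Real.rpow_mul (by positivity), show q / p * (p / q) = 1 by field_simp, Real.rpow_one,
      lt_div_iff₀ hc, mul_comm] at h3
    exact h3
  set ν := (volume : Measure (EuclideanSpace ℝ (Fin n))).withDensity F with hν
  have hFr : Measurable fun x => (F x).toReal := hF.ennreal_toReal
  have h4 : ∀ h : ℝ, 0 < h → ∫⁻ y in {y | ENNReal.ofReal h < F y}, F y = ν {y | h < (F y).toReal} := by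
    intro h hh
    have : {y | ENNReal.ofReal h < F y} = {y | h < (F y).toReal} := by
      ext y
      exact ENNReal.ofReal_lt_iff_lt_toReal hh.le (hFt y)
    rw [this, hν, withDensity_apply _ (measurableSet_lt measurable_const hFr)]
  have h5 := lintegral_rpow_eq_lintegral_meas_lt_mul ν (f := fun x => (F x).toReal)
    (Filter.Eventually.of_forall fun x => ENNReal.toReal_nonneg) hFr.aemeasurable (p := p - 1) (by linarith)
  have h6 : ∫⁻ x, ENNReal.ofReal ((F x).toReal ^ (p - 1)) ∂ν = ∫⁻ x, F x ^ p := by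
    rw [hν, lintegral_withDensity_eq_lintegral_mul _ hF (by fun_prop)]
    congr 1; ext x
    rw [Pi.mul_apply, ← ENNReal.ofReal_rpow_of_nonneg ENNReal.toReal_nonneg (by linarith),
      ENNReal.ofReal_toReal (hFt x)]
    nth_rewrite 1 [← ENNReal.rpow_one (F x)]
    rw [← ENNReal.rpow_add_of_nonneg _ _ zero_le_one (by linarith)]
    congr 1; ring
  have h7 := lintegral_rpow_eq_lintegral_meas_lt_mul volume (f := T)
    (Filter.Eventually.of_forall hT0) hTm.aemeasurable hp0
  have hp1 : 0 < p - 1 := by linarith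
  have h8 : ∫⁻ t in Set.Ioi (0 : ℝ), ν {y | t < (F y).toReal} * ENNReal.ofReal (t ^ (p - 1 - 1)) ≤
      ENNReal.ofReal (p - 1)⁻¹ := by
    rw [h6] at h5
    have : ENNReal.ofReal (p - 1) * ∫⁻ t in Set.Ioi (0 : ℝ), ν {y | t < (F y).toReal} * ENNReal.ofReal (t ^ (p - 1 - 1)) ≤ 1 := h5 ▸ hF1
    rw [ENNReal.ofReal_inv_of_pos hp1, ← one_div]
    rw [ENNReal.le_div_iff_mul_le (by simp [hp]) (by simp), mul_comm]
    exact this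
  change ∫⁻ x, G x ^ q ≤ _
  simp_rw [h1]
  rw [lintegral_const_mul' _ _ ENNReal.ofReal_ne_top, h7, ENNReal.ofReal_mul (by positivity)]
  gcongr
  rw [mul_assoc, ENNReal.ofReal_mul hp0.le, ENNReal.ofReal_mul hC.le]
  gcongr
  calc ∫⁻ t in Set.Ioi (0 : ℝ), volume {x | t < T x} * ENNReal.ofReal (t ^ (p - 1))
      ≤ ∫⁻ t in Set.Ioi (0 : ℝ), ENNReal.ofReal C * (ν {y | t < (F y).toReal} * ENNReal.ofReal (t ^ (p - 1 - 1))) := by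
        apply setLIntegral_mono' measurableSet_Ioi
        intro t ht
        have ht' : 0 < t := ht
        calc volume {x | t < T x} * ENNReal.ofReal (t ^ (p - 1)) ≤
            (ENNReal.ofReal (C * t⁻¹) * ν {y | t < (F y).toReal}) * ENNReal.ofReal (t ^ (p - 1)) := by
              gcongr
              rw [← h4 t ht]; exact h2 t ht
          _ = _ := by
              rw [Real.rpow_sub_one ht'.ne' (p - 1), div_eq_mul_inv, ENNReal.ofReal_mul hC.le,
                ENNReal.ofReal_mul (by positivity : 0 ≤ t ^ (p - 1))]
              ring
    _ = ENNReal.ofReal C * ∫⁻ t in Set.Ioi (0 : ℝ), (ν {y | t < (F y).toReal} * ENNReal.ofReal (t ^ (p - 1 - 1))) := by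
        rw [lintegral_const_mul' _ _ ENNReal.ofReal_ne_top]
    _ ≤ _ := by gcongr
theorem aux_young {n : ℕ} {p q r : ℝ} (hp : 1 ≤ p) (hpq : p ≤ q) (hr : 0 < r)
    (hrel : 1 / r = 1 - 1 / p + 1 / q)
    {κ : EuclideanSpace ℝ (Fin n) → ℝ≥0∞} (hκm : Measurable κ)
    {F : EuclideanSpace ℝ (Fin n) → ℝ≥0∞} (hF : Measurable F) (hF1 : ∫⁻ x, F x ^ p ≤ 1) :
    ∫⁻ x, (∫⁻ y, κ (x - y) * F y) ^ q ≤
      (∫⁻ x, κ x ^ r) * ((∫⁻ x, κ x ^ r) ^ (1 / r - 1 / q)) ^ q := by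
  have hp0 : 0 < p := by linarith
  have hq0 : 0 < q := by linarith
  have e1 : 0 ≤ 1 / r - 1 / q := by
    rw [hrel]
    have : 1 / p ≤ 1 := by rw [div_le_one hp0]; exact hp
    linarith
  have e2 : 0 ≤ 1 / p - 1 / q := by
    have : 1 / q ≤ 1 / p := one_div_le_one_div_of_le hp0 hpq
    linarith
  have hq1 : 0 ≤ 1 / q := by positivity
  set K := ∫⁻ x, κ x ^ r with hK
  have hpt : ∀ x, ∫⁻ y, κ (x - y) * F y ≤
      (∫⁻ y, κ (x - y) ^ r * F y ^ p) ^ (1 / q) * K ^ (1 / r - 1 / q) := by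
    intro x
    have hh := ENNReal.lintegral_prod_norm_pow_le (μ := volume) (Finset.univ : Finset (Fin 3))
      (f := ![fun y => κ (x - y) ^ r * F y ^ p, fun y => κ (x - y) ^ r, fun y => F y ^ p])
      (p := ![1 / q, 1 / r - 1 / q, 1 / p - 1 / q])
      (by
        intro i _
        fin_cases i <;> simp <;> fun_prop)
      (by
        simp only [Fin.sum_univ_three, Matrix.cons_val_zero, Matrix.cons_val_one, Matrix.cons_val]
        rw [hrel]; ring)
      (by
        intro i _
        fin_cases i
        · exact hq1
        · exact e1
        · exact e2)
    simp only [Fin.prod_univ_three, Matrix.cons_val_zero, Matrix.cons_val_one, Matrix.cons_val] at hh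
    calc ∫⁻ y, κ (x - y) * F y = ∫⁻ y, (κ (x - y) ^ r * F y ^ p) ^ (1 / q) *
          (κ (x - y) ^ r) ^ (1 / r - 1 / q) * (F y ^ p) ^ (1 / p - 1 / q) := by
          congr 1; ext y
          rw [ENNReal.mul_rpow_of_nonneg _ _ hq1, ← ENNReal.rpow_mul, ← ENNReal.rpow_mul,
            ← ENNReal.rpow_mul, ← ENNReal.rpow_mul]
          have a1 : κ (x - y) = κ (x - y) ^ (r * (1 / q)) * κ (x - y) ^ (r * (1 / r - 1 / q)) := by
            rw [← ENNReal.rpow_add_of_nonneg _ _ (by positivity) (by positivity)]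
            rw [← mul_add, add_sub_cancel, mul_one_div_cancel hr.ne', ENNReal.rpow_one]
          have a2 : F y = F y ^ (p * (1 / q)) * F y ^ (p * (1 / p - 1 / q)) := by
            rw [← ENNReal.rpow_add_of_nonneg _ _ (by positivity) (by positivity)]
            rw [← mul_add, add_sub_cancel, mul_one_div_cancel hp0.ne', ENNReal.rpow_one]
          nth_rewrite 1 [a1]
          nth_rewrite 1 [a2]
          ring
      _ ≤ _ := hh
      _ ≤ (∫⁻ y, κ (x - y) ^ r * F y ^ p) ^ (1 / q) * K ^ (1 / r - 1 / q) * 1 := by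
          rw [lintegral_sub_left_eq_self (fun z => κ z ^ r) x]
          gcongr
          calc (∫⁻ y, F y ^ p) ^ (1 / p - 1 / q) ≤ 1 ^ (1 / p - 1 / q) := ENNReal.rpow_le_rpow hF1 e2
            _ = 1 := ENNReal.one_rpow _
      _ = _ := mul_one _
  calc ∫⁻ x, (∫⁻ y, κ (x - y) * F y) ^ q ≤
      ∫⁻ x, (∫⁻ y, κ (x - y) ^ r * F y ^ p) * (K ^ (1 / r - 1 / q)) ^ q := by
        apply lintegral_mono; intro x
        calc _ ≤ _ := ENNReal.rpow_le_rpow (hpt x) hq0.le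
          _ = _ := by
            rw [ENNReal.mul_rpow_of_nonneg _ _ hq0.le, ← ENNReal.rpow_mul, one_div_mul_cancel hq0.ne',
              ENNReal.rpow_one]
    _ = (∫⁻ x, ∫⁻ y, κ (x - y) ^ r * F y ^ p) * (K ^ (1 / r - 1 / q)) ^ q := by
        rw [lintegral_mul_const]
        apply Measurable.lintegral_prod_right'
          (f := fun z : EuclideanSpace ℝ (Fin n) × EuclideanSpace ℝ (Fin n) => κ (z.1 - z.2) ^ r * F z.2 ^ p)
        fun_prop
    _ ≤ _ := by
        rw [aux_conv_L1 (κ := fun x => κ x ^ r) (g := fun x => F x ^ p) (by fun_prop) (by fun_prop)]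
        gcongr
        calc K * ∫⁻ y, F y ^ p ≤ K * 1 := by gcongr
          _ = K := mul_one _

theorem aux_kappa_Lr {n : ℕ} (hn : 2 ≤ n) {lam r : ℝ} (hr : 1 ≤ r) (hl' : lam * r < n)
    {κ : EuclideanSpace ℝ (Fin n) → ℝ≥0∞} {A : ℝ} (hA : 0 < A)
    (hκ : ∀ x, κ x ≤ ENNReal.ofReal (A * ‖x‖ ^ (-lam)))
    (hκ' : ∀ x, κ x ≤ ENNReal.ofReal (A * ‖x‖ ^ (-(2 * n : ℝ)))) :
    ∫⁻ x, κ x ^ r ≠ ∞ := by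
  have hn0 : (0 : ℝ) < n := by positivity
  have hr0 : 0 < r := by linarith
  obtain ⟨c2, hc2, H2⟩ := aux_lint_near hn hl'
  obtain ⟨c1, hc1, H1⟩ := aux_lint_far hn (μ := 2 * n * r) (by nlinarith)
  have gen : ∀ (l : ℝ) (s : Set (EuclideanSpace ℝ (Fin n))),
      (∀ x, κ x ≤ ENNReal.ofReal (A * ‖x‖ ^ (-l))) →
      ∫⁻ x in s, κ x ^ r ≤ ENNReal.ofReal (A ^ r) * ∫⁻ x in s, ENNReal.ofReal (‖x‖ ^ (-(l * r))) := by
    intro l s hl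
    calc ∫⁻ x in s, κ x ^ r ≤ ∫⁻ x in s, ENNReal.ofReal (A ^ r) * ENNReal.ofReal (‖x‖ ^ (-(l * r))) := by
            apply lintegral_mono; intro x
            calc κ x ^ r ≤ (ENNReal.ofReal (A * ‖x‖ ^ (-l))) ^ r :=
                  ENNReal.rpow_le_rpow (hl x) hr0.le
              _ = _ := by
                  rw [ENNReal.ofReal_rpow_of_nonneg (by positivity) hr0.le,
                    Real.mul_rpow hA.le (by positivity), ← Real.rpow_mul (norm_nonneg x),
                    ENNReal.ofReal_mul (by positivity), neg_mul]
        _ = _ := by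
            rw [lintegral_const_mul']; simp
  rw [← lintegral_add_compl _ (measurableSet_ball (x := (0 : EuclideanSpace ℝ (Fin n))) (ε := 1))]
  refine ENNReal.add_ne_top.2 ⟨?_, ?_⟩
  · refine ne_top_of_le_ne_top ?_ ((gen lam _ hκ).trans (mul_le_mul_right (H2 1 one_pos) _))
    exact ENNReal.mul_ne_top ENNReal.ofReal_ne_top ENNReal.ofReal_ne_top
  · refine ne_top_of_le_ne_top ?_ ((gen (2 * n) _ hκ').trans (mul_le_mul_right (H1 1 one_pos) _))
    exact ENNReal.mul_ne_top ENNReal.ofReal_ne_top ENNReal.ofReal_ne_top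

theorem aux_normalize {n : ℕ} {p q : ℝ} (hp : 1 ≤ p) (hq : 0 < q)
    {κ : EuclideanSpace ℝ (Fin n) → ℝ≥0∞}
    {C : ℝ} (hC : 0 < C)
    (H : ∀ F : EuclideanSpace ℝ (Fin n) → ℝ≥0∞, Measurable F → (∀ x, F x ≠ ∞) →
      (∀ x, ∫⁻ y, κ (x - y) * F y ≠ ∞) →
      ∫⁻ x, F x ^ p ≤ 1 → ∫⁻ x, (∫⁻ y, κ (x - y) * F y) ^ q ≤ ENNReal.ofReal C)
    (f : SchwartzMap (EuclideanSpace ℝ (Fin n)) ℂ) (u : EuclideanSpace ℝ (Fin n) → ℂ)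
    (hG : ∀ x, ∫⁻ y, κ (x - y) * ‖f y‖ₑ ≠ ∞)
    (hu : ∀ x, ‖u x‖ₑ ≤ ∫⁻ y, κ (x - y) * ‖f y‖ₑ) :
    eLpNorm u (ENNReal.ofReal q) volume ≤
      ENNReal.ofReal (C ^ (1 / q)) * eLpNorm f (ENNReal.ofReal p) volume := by
  have hp0 : 0 < p := by linarith
  have hfm : Measurable fun y => ‖f y‖ₑ := f.continuous.enorm.measurable
  have Nform : eLpNorm f (ENNReal.ofReal p) volume = (∫⁻ y, ‖f y‖ₑ ^ p) ^ (1 / p) := by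
    rw [eLpNorm_eq_lintegral_rpow_enorm_toReal (by simpa using hp0) ENNReal.ofReal_ne_top,
      ENNReal.toReal_ofReal hp0.le]
  have hNt : eLpNorm f (ENNReal.ofReal p) volume ≠ ∞ := (f.memLp (ENNReal.ofReal p) volume).eLpNorm_ne_top
  set N := eLpNorm f (ENNReal.ofReal p) volume with hN
  by_cases hN0 : N = 0
  · have hf0 : (f : EuclideanSpace ℝ (Fin n) → ℂ) =ᵐ[volume] 0 := by
      rw [hN, eLpNorm_eq_zero_iff f.continuous.aestronglyMeasurable (by simpa using hp0)] at hN0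
      exact hN0
    have : ∀ x, u x = 0 := by
      intro x
      have h1 : ∫⁻ y, κ (x - y) * ‖f y‖ₑ = 0 := by
        rw [← lintegral_zero (μ := (volume : Measure (EuclideanSpace ℝ (Fin n))))]
        apply lintegral_congr_ae
        filter_upwards [hf0] with y hy
        simp [hy]
      have := hu x
      rw [h1] at this
      simpa using this
    have : u = 0 := funext this
    rw [this, eLpNorm_zero]
    exact zero_le
  have hscale : ∀ x, ∫⁻ y, κ (x - y) * (‖f y‖ₑ * N⁻¹) = (∫⁻ y, κ (x - y) * ‖f y‖ₑ) * N⁻¹ := by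
    intro x
    rw [← lintegral_mul_const' _ _ (by simpa using hN0)]
    congr 1; ext y; ring
  have hNit : N⁻¹ ≠ ∞ := by simpa using hN0
  have h1 := H (fun y => ‖f y‖ₑ * N⁻¹) (by fun_prop)
    (fun x => ENNReal.mul_ne_top enorm_ne_top hNit)
    (fun x => by rw [hscale]; exact ENNReal.mul_ne_top (hG x) hNit)
    (by
      simp_rw [ENNReal.mul_rpow_of_nonneg _ _ hp0.le]
      rw [lintegral_mul_const' _ _ (ENNReal.rpow_ne_top_of_nonneg hp0.le hNit)]
      have : ∫⁻ y, ‖f y‖ₑ ^ p = N ^ p := by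
        rw [Nform, ← ENNReal.rpow_mul, one_div_mul_cancel hp0.ne', ENNReal.rpow_one]
      rw [this, ← ENNReal.mul_rpow_of_nonneg _ _ hp0.le, ENNReal.mul_inv_cancel hN0 hNt, ENNReal.one_rpow])
  simp_rw [hscale, ENNReal.mul_rpow_of_nonneg _ _ hq.le] at h1
  rw [lintegral_mul_const' _ _ (ENNReal.rpow_ne_top_of_nonneg hq.le hNit), ENNReal.inv_rpow,
    ← div_eq_mul_inv, ENNReal.div_le_iff (by simp [hN0, hq]; exact fun h => absurd h hNt) (ENNReal.rpow_ne_top_of_nonneg hq.le hNt)] at h1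
  rw [eLpNorm_eq_lintegral_rpow_enorm_toReal (by simpa using hq) ENNReal.ofReal_ne_top,
      ENNReal.toReal_ofReal hq.le]
  calc (∫⁻ x, ‖u x‖ₑ ^ q) ^ (1 / q) ≤ (ENNReal.ofReal C * N ^ q) ^ (1 / q) := by
        apply ENNReal.rpow_le_rpow _ (by positivity)
        refine le_trans (lintegral_mono fun x => ?_) h1
        exact ENNReal.rpow_le_rpow (hu x) hq.le
    _ = _ := by
        rw [ENNReal.mul_rpow_of_nonneg _ _ (by positivity), ← ENNReal.rpow_mul, mul_one_div_cancel hq.ne',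
          ENNReal.rpow_one, ENNReal.ofReal_rpow_of_pos hC]

theorem aux_kernel_bound {n : ℕ} (hn : 2 ≤ n) {lam : ℝ} (hl : 0 < lam) (hl' : lam < n)
    {κ : EuclideanSpace ℝ (Fin n) → ℝ≥0∞} (hκm : Measurable κ) {A : ℝ} (hA : 0 < A)
    (hκ : ∀ x, κ x ≤ ENNReal.ofReal (A * ‖x‖ ^ (-lam)))
    (hκ' : ∀ x, κ x ≤ ENNReal.ofReal (A * ‖x‖ ^ (-(2 * n : ℝ))))
    (p q : ℝ≥0∞) (hp : 1 ≤ p) (hpq : p ≤ q)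
    (hup : (1/p).toReal - (1/q).toReal ≤ (n - lam) / (n : ℝ))
    (hex1 : ¬(p = ENNReal.ofReal ((n : ℝ) / (n - lam)) ∧ q = ∞))
    (hex2 : ¬(p = 1 ∧ q = ENNReal.ofReal ((n : ℝ) / lam))) :
    ∃ C : ℝ, 0 < C ∧ ∀ (f : SchwartzMap (EuclideanSpace ℝ (Fin n)) ℂ)
      (u : EuclideanSpace ℝ (Fin n) → ℂ),
      (∀ x, ‖u x‖ₑ ≤ ∫⁻ y, κ (x - y) * ‖f y‖ₑ) →
      eLpNorm u q volume ≤ ENNReal.ofReal C * eLpNorm f p volume := by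
  have hn0 : (0 : ℝ) < n := by positivity
  have hL1 : ∫⁻ x, κ x ≠ ∞ := by
    have := aux_kappa_Lr hn (le_refl (1:ℝ)) (by simpa using hl') hA hκ hκ'
    simpa using this
  have hGb : ∀ (f : SchwartzMap (EuclideanSpace ℝ (Fin n)) ℂ) (x : EuclideanSpace ℝ (Fin n)),
      ∫⁻ y, κ (x - y) * ‖f y‖ₑ ≤ (∫⁻ y, κ y) * eLpNorm f ∞ volume := by
    intro f x
    calc ∫⁻ y, κ (x - y) * ‖f y‖ₑ ≤ ∫⁻ y, κ (x - y) * eLpNorm f ∞ volume := by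
          apply lintegral_mono_ae
          rw [eLpNorm_exponent_top]
          filter_upwards [enorm_ae_le_eLpNormEssSup f volume] with y hy
          gcongr
      _ = _ := by
          rw [lintegral_mul_const _ (by fun_prop), lintegral_sub_left_eq_self κ x]
  have hGt : ∀ (f : SchwartzMap (EuclideanSpace ℝ (Fin n)) ℂ) (x : EuclideanSpace ℝ (Fin n)),
      ∫⁻ y, κ (x - y) * ‖f y‖ₑ ≠ ∞ := fun f x =>
    ne_top_of_le_ne_top (ENNReal.mul_ne_top hL1 (f.memLp ∞ volume).eLpNorm_ne_top) (hGb f x)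
  have htop : ∀ D : ℝ≥0∞, D ≠ ∞ → D ≤ ENNReal.ofReal (D.toReal + 1) := by
    intro D hD
    nth_rewrite 1 [← ENNReal.ofReal_toReal hD]
    exact ENNReal.ofReal_le_ofReal (by linarith)
  have hfm : ∀ f : SchwartzMap (EuclideanSpace ℝ (Fin n)) ℂ, Measurable fun y => ‖f y‖ₑ :=
    fun f => f.continuous.enorm.measurable
  by_cases hq : q = ∞
  · subst hq
    by_cases hpt : p = ∞
    · subst hpt
      refine ⟨(∫⁻ y, κ y).toReal + 1, by positivity, fun f u hu => ?_⟩
      rw [eLpNorm_exponent_top (f := u)]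
      refine eLpNormEssSup_le_of_ae_enorm_bound (Filter.Eventually.of_forall fun x => ?_)
      refine (hu x).trans ((hGb f x).trans ?_)
      gcongr
      exact htop _ hL1
    · obtain ⟨s, hs, rfl⟩ : ∃ s : ℝ, 0 ≤ s ∧ p = ENNReal.ofReal s :=
        ⟨p.toReal, ENNReal.toReal_nonneg, (ENNReal.ofReal_toReal hpt).symm⟩
      have hs1 : 1 ≤ s := by simpa using hp
      have hs0 : 0 < s := by linarith
      have hup' : 1 / s ≤ (n - lam) / n := by
        simpa [ENNReal.toReal_inv, ENNReal.toReal_ofReal hs] using hup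
      have hne : 1 / s ≠ (n - lam) / n := by
        intro h
        apply hex1
        refine ⟨?_, rfl⟩
        rw [← one_div_one_div s, h, one_div_div]
      have hlt : 1 / s < 1 - lam / n := by
        have : (n - lam) / n = 1 - lam / n := by field_simp
        rw [← this]; exact lt_of_le_of_ne hup' hne
      have hs1' : 1 < s := by
        rcases hs1.eq_or_lt with h | h
        · rw [← h] at hlt
          have : 0 < lam / n := by positivity
          norm_num at hlt
          linarith
        · exact h
      set s' := s / (s - 1) with hs'
      have hs'1 : 1 ≤ s' := by
        rw [hs', le_div_iff₀ (by linarith)]; linarith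
      have hconj : s'.HolderConjugate s := (Real.HolderConjugate.conjExponent hs1').symm
      have hK := aux_kappa_Lr hn (lam := lam) (r := s') hs'1 (by
        have h3 : 1 / s * (s * n) < (1 - lam / n) * (s * n) :=
          mul_lt_mul_of_pos_right hlt (by positivity)
        have h4 : 1 / s * (s * n) = n := by field_simp
        have h5 : (1 - lam / n) * (s * n) = s * n - lam * s := by field_simp
        rw [h4, h5] at h3
        rw [hs', ← mul_div_assoc, div_lt_iff₀ (by linarith)]
        nlinarith) hA hκ hκ'
      have hKt : (∫⁻ x, κ x ^ s') ^ (1 / s') ≠ ∞ :=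
        ENNReal.rpow_ne_top_of_nonneg (by positivity) hK
      refine ⟨((∫⁻ x, κ x ^ s') ^ (1 / s')).toReal + 1, by positivity, fun f u hu => ?_⟩
      rw [eLpNorm_exponent_top (f := u)]
      refine eLpNormEssSup_le_of_ae_enorm_bound (Filter.Eventually.of_forall fun x => ?_)
      refine (hu x).trans ?_
      have hfm' := hfm f
      calc ∫⁻ y, κ (x - y) * ‖f y‖ₑ ≤
          (∫⁻ y, κ (x - y) ^ s') ^ (1 / s') * (∫⁻ y, ‖f y‖ₑ ^ s) ^ (1 / s) :=
            ENNReal.lintegral_mul_le_Lp_mul_Lq volume hconj (by fun_prop) hfm'.aemeasurable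
        _ = (∫⁻ y, κ y ^ s') ^ (1 / s') * eLpNorm f (ENNReal.ofReal s) volume := by
            rw [lintegral_sub_left_eq_self (fun z => κ z ^ s') x,
              eLpNorm_eq_lintegral_rpow_enorm_toReal (by simpa using hs0) ENNReal.ofReal_ne_top,
              ENNReal.toReal_ofReal hs0.le]
        _ ≤ _ := by
            gcongr
            exact htop _ hKt
  · have hpt : p ≠ ∞ := ne_top_of_le_ne_top hq hpq
    obtain ⟨s, hs, rfl⟩ : ∃ s : ℝ, 0 ≤ s ∧ p = ENNReal.ofReal s :=
        ⟨p.toReal, ENNReal.toReal_nonneg, (ENNReal.ofReal_toReal hpt).symm⟩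
    obtain ⟨t, ht, rfl⟩ : ∃ s : ℝ, 0 ≤ s ∧ q = ENNReal.ofReal s :=
        ⟨q.toReal, ENNReal.toReal_nonneg, (ENNReal.ofReal_toReal hq).symm⟩
    have hs1 : 1 ≤ s := by simpa using hp
    have hst : s ≤ t := (ENNReal.ofReal_le_ofReal_iff ht).1 hpq
    have hs0 : 0 < s := by linarith
    have ht0 : 0 < t := by linarith
    have hup' : 1 / s - 1 / t ≤ 1 - lam / n := by
      have e : (n - lam) / n = 1 - lam / n := by field_simp
      rw [e] at hup
      simpa [ENNReal.toReal_inv, ENNReal.toReal_ofReal hs, ENNReal.toReal_ofReal ht] using hup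
    rcases hup'.lt_or_eq with hlt | heq
    · have hts : 1 / t ≤ 1 / s := one_div_le_one_div_of_le hs0 hst
      have hs1' : 1 / s ≤ 1 := by rw [div_le_one hs0]; exact hs1
      have htpos : 0 < 1 / t := by positivity
      set r := 1 / (1 - 1 / s + 1 / t) with hr
      have hd : 0 < 1 - 1 / s + 1 / t := by linarith
      have hr1 : 1 ≤ r := by
        rw [hr, le_div_iff₀ hd]; linarith
      have hr0 : 0 < r := by linarith
      have hK := aux_kappa_Lr hn (lam := lam) (r := r) hr1 (by
        rw [hr, mul_one_div, div_lt_iff₀ hd, ← div_lt_iff₀' hn0]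
        linarith) hA hκ hκ'
      have hrel : 1 / r = 1 - 1 / s + 1 / t := by rw [hr, one_div_one_div]
      set D := (∫⁻ x, κ x ^ r) * ((∫⁻ x, κ x ^ r) ^ (1 / r - 1 / t)) ^ t with hDdef
      have hDt : D ≠ ∞ := by
        refine ENNReal.mul_ne_top hK (ENNReal.rpow_ne_top_of_nonneg ht0.le
          (ENNReal.rpow_ne_top_of_nonneg ?_ hK))
        rw [hrel]; linarith
      have hC : 0 < D.toReal + 1 := by positivity
      refine ⟨(D.toReal + 1) ^ (1 / t), by positivity, fun f u hu => ?_⟩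
      refine aux_normalize hs1 ht0 hC ?_ f u (hGt f) hu
      intro F hF _ _ hF1
      exact (aux_young hs1 hst hr0 hrel hκm hF hF1).trans (htop _ hDt)
    · have hs1' : 1 < s := by
        rcases hs1.eq_or_lt with h | h
        · exfalso
          apply hex2
          rw [← h] at heq ⊢
          refine ⟨by simp, ?_⟩
          have : 1 / t = lam / n := by
            norm_num at heq ⊢; linarith
          rw [← one_div_one_div t, this, one_div_div]
        · exact h
      obtain ⟨C, hC, H⟩ := aux_HLS hn hl hl' hs1' ht0 (by linarith) hκm hA hκ
      exact ⟨C ^ (1 / t), by positivity, fun f u hu => aux_normalize hs1 ht0 hC H f u (hGt f) hu⟩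
theorem aux_dyadic_sum {μ : ℝ} (hμ : 0 < μ) :
    ∃ S : ℝ, 0 < S ∧ ∀ ρ : ℝ, 0 < ρ →
      ∑' j : ℕ, ENNReal.ofReal ((2 ^ j * ρ) ^ μ * min 1 ((2 ^ j * ρ) ^ (-(2 * μ)))) ≤
        ENNReal.ofReal S := by
  set b : ℝ := (2 : ℝ) ^ (-μ) with hb
  have hb0 : 0 < b := by positivity
  have hb1 : b < 1 := Real.rpow_lt_one_of_one_lt_of_neg (by norm_num) (by linarith)
  set g : ℤ → ℝ := fun i => 2 ^ μ * b ^ i.natAbs with hg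
  have hgs : Summable g := by
    apply Summable.mul_left
    apply Summable.of_nat_of_neg
    · simpa using summable_geometric_of_lt_one hb0.le hb1
    · simpa using summable_geometric_of_lt_one hb0.le hb1
  have hg0 : ∀ i, 0 ≤ g i := fun i => by positivity
  refine ⟨(∑' i, g i) + 1, by
    have : 0 ≤ ∑' i, g i := tsum_nonneg hg0
    positivity, fun ρ hρ => ?_⟩
  obtain ⟨k, hk1, hk2⟩ := exists_mem_Ico_zpow (y := (2 : ℝ)) hρ (by norm_num)
  have hterm : ∀ j : ℕ, (2 ^ j * ρ) ^ μ * min 1 ((2 ^ j * ρ) ^ (-(2 * μ))) ≤ g (j + k) := by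
    intro j
    set u : ℝ := 2 ^ j * ρ with hu
    have hu0 : 0 < u := by positivity
    have hu1 : (2 : ℝ) ^ ((j : ℤ) + k) ≤ u := by
      rw [zpow_add₀ (by norm_num), zpow_natCast, hu]
      gcongr
    have hu2 : u ≤ (2 : ℝ) ^ ((j : ℤ) + k) * 2 := by
      rw [zpow_add₀ (by norm_num), zpow_natCast, hu, mul_assoc]
      rw [zpow_add_one₀ (by norm_num)] at hk2
      gcongr
    set i : ℤ := (j : ℤ) + k with hi
    have h2μ : 1 ≤ (2 : ℝ) ^ μ := Real.one_le_rpow (by norm_num) hμ.le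
    rcases le_or_gt 0 i with h | h
    · obtain ⟨a, ha⟩ := Int.eq_ofNat_of_zero_le h
      rw [ha, zpow_natCast] at hu1
      calc u ^ μ * min 1 (u ^ (-(2 * μ))) ≤ u ^ μ * u ^ (-(2 * μ)) := by
            gcongr; exact min_le_right _ _
        _ = u ^ (-μ) := by rw [← Real.rpow_add hu0]; congr 1; ring
        _ ≤ ((2 : ℝ) ^ a) ^ (-μ) := Real.rpow_le_rpow_of_nonpos (by positivity) hu1 (by linarith)
        _ = b ^ a := by
            rw [hb, ← Real.rpow_natCast 2 a, ← Real.rpow_mul (by norm_num), ← Real.rpow_mul_natCast (by norm_num)]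
            congr 1; ring
        _ ≤ 2 ^ μ * b ^ a := le_mul_of_one_le_left (by positivity) h2μ
        _ = g i := by simp [hg, ha]
    · obtain ⟨a, ha⟩ := Int.exists_eq_neg_ofNat h.le
      rw [ha, zpow_neg, zpow_natCast] at hu2
      calc u ^ μ * min 1 (u ^ (-(2 * μ))) ≤ u ^ μ * 1 := by
            gcongr; exact min_le_left _ _
        _ = u ^ μ := mul_one _
        _ ≤ (((2 : ℝ) ^ a)⁻¹ * 2) ^ μ := Real.rpow_le_rpow hu0.le hu2 hμ.le
        _ = 2 ^ μ * b ^ a := by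
            rw [Real.mul_rpow (by positivity) (by norm_num), mul_comm]
            congr 1
            rw [hb, ← Real.rpow_natCast 2 a, ← Real.rpow_neg (by norm_num), ← Real.rpow_mul (by norm_num), ← Real.rpow_mul_natCast (by norm_num)]
            congr 1; ring
        _ = g i := by simp [hg, ha]
  have hinj : Function.Injective fun j : ℕ => (j : ℤ) + k := fun a c h => by simpa using h
  calc ∑' j : ℕ, ENNReal.ofReal ((2 ^ j * ρ) ^ μ * min 1 ((2 ^ j * ρ) ^ (-(2 * μ)))) ≤
      ∑' j : ℕ, ENNReal.ofReal (g (j + k)) :=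
        ENNReal.tsum_le_tsum fun j => ENNReal.ofReal_le_ofReal (hterm j)
    _ ≤ ∑' i : ℤ, ENNReal.ofReal (g i) :=
        ENNReal.tsum_comp_le_tsum_of_injective hinj (fun i => ENNReal.ofReal (g i))
    _ = ENNReal.ofReal (∑' i, g i) := (ENNReal.ofReal_tsum_of_nonneg hg0 hgs).symm
    _ ≤ _ := ENNReal.ofReal_le_ofReal (by linarith)

theorem aux_kappa_exists {n : ℕ} (hn : 2 ≤ n) {lam : ℝ} (hl : 0 < lam) (hl' : lam < n)
    {C : ℝ} (hC : 0 < C) :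
    ∃ (κ : EuclideanSpace ℝ (Fin n) → ℝ≥0∞) (A : ℝ), Measurable κ ∧ 0 < A ∧
      (∀ x, κ x ≤ ENNReal.ofReal (A * ‖x‖ ^ (-lam))) ∧
      (∀ x, κ x ≤ ENNReal.ofReal (A * ‖x‖ ^ (-(2 * n : ℝ)))) ∧
      ∀ x, x ≠ 0 → ∑' j : ℕ, ENNReal.ofReal
        (C * ((2 : ℝ) ^ j) ^ lam * min 1 ((2 ^ j * ‖x‖) ^ (-(4 * n : ℝ)))) ≤ κ x := by
  have hn0 : (0 : ℝ) < n := by positivity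
  obtain ⟨S1, hS1, H1⟩ := aux_dyadic_sum hl
  obtain ⟨S2, hS2, H2⟩ := aux_dyadic_sum (μ := 2 * n) (by positivity)
  set A := C * max S1 S2 with hA
  have hgen : ∀ (μ S : ℝ), 0 < S → lam ≤ μ → μ ≤ 2 * n → S ≤ max S1 S2 →
      (∀ ρ : ℝ, 0 < ρ →
      ∑' j : ℕ, ENNReal.ofReal ((2 ^ j * ρ) ^ μ * min 1 ((2 ^ j * ρ) ^ (-(2 * μ)))) ≤
        ENNReal.ofReal S) → ∀ x : EuclideanSpace ℝ (Fin n), x ≠ 0 →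
      ∑' j : ℕ, ENNReal.ofReal
        (C * ((2 : ℝ) ^ j) ^ lam * min 1 ((2 ^ j * ‖x‖) ^ (-(4 * n : ℝ)))) ≤
        ENNReal.ofReal (A * ‖x‖ ^ (-μ)) := by
    intro μ S hS h1 h2 h3 H x hx
    have hx0 : 0 < ‖x‖ := norm_pos_iff.2 hx
    calc ∑' j : ℕ, ENNReal.ofReal (C * ((2 : ℝ) ^ j) ^ lam * min 1 ((2 ^ j * ‖x‖) ^ (-(4 * n : ℝ)))) ≤
        ∑' j : ℕ, ENNReal.ofReal (C * ‖x‖ ^ (-μ)) *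
          ENNReal.ofReal ((2 ^ j * ‖x‖) ^ μ * min 1 ((2 ^ j * ‖x‖) ^ (-(2 * μ)))) := by
          apply ENNReal.tsum_le_tsum
          intro j
          rw [← ENNReal.ofReal_mul (by positivity)]
          apply ENNReal.ofReal_le_ofReal
          set u : ℝ := 2 ^ j * ‖x‖ with hu
          have hu0 : 0 < u := by positivity
          have e1 : ((2 : ℝ) ^ j) ^ lam ≤ ‖x‖ ^ (-μ) * u ^ μ := by
            have : ‖x‖ ^ (-μ) * u ^ μ = ((2 : ℝ) ^ j) ^ μ := by
              rw [hu, Real.mul_rpow (by positivity) hx0.le, mul_comm, mul_assoc, ← Real.rpow_add hx0]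
              simp
            rw [this]
            exact Real.rpow_le_rpow_of_exponent_le (one_le_pow₀ (by norm_num)) h1
          have e2 : min 1 (u ^ (-(4 * n : ℝ))) ≤ min 1 (u ^ (-(2 * μ))) := by
            rcases le_or_gt 1 u with hu1 | hu1
            · exact min_le_min_left _ (Real.rpow_le_rpow_of_exponent_le hu1 (by linarith))
            · have : 1 ≤ u ^ (-(2 * μ)) :=
                Real.one_le_rpow_of_pos_of_le_one_of_nonpos hu0 hu1.le (by linarith)
              rw [min_eq_left this]; exact min_le_left _ _
          calc C * ((2 : ℝ) ^ j) ^ lam * min 1 (u ^ (-(4 * n : ℝ))) ≤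
              C * (‖x‖ ^ (-μ) * u ^ μ) * min 1 (u ^ (-(2 * μ))) := by gcongr
            _ = _ := by ring
      _ = ENNReal.ofReal (C * ‖x‖ ^ (-μ)) *
          ∑' j : ℕ, ENNReal.ofReal ((2 ^ j * ‖x‖) ^ μ * min 1 ((2 ^ j * ‖x‖) ^ (-(2 * μ)))) :=
          ENNReal.tsum_mul_left
      _ ≤ ENNReal.ofReal (C * ‖x‖ ^ (-μ)) * ENNReal.ofReal S := by gcongr; exact H _ hx0
      _ = ENNReal.ofReal (C * ‖x‖ ^ (-μ) * S) := by rw [← ENNReal.ofReal_mul (by positivity)]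
      _ ≤ _ := by
          apply ENNReal.ofReal_le_ofReal
          rw [hA, mul_right_comm]
          gcongr
  refine ⟨fun x => min (ENNReal.ofReal (A * ‖x‖ ^ (-lam))) (ENNReal.ofReal (A * ‖x‖ ^ (-(2 * n : ℝ)))),
    A, by fun_prop, by positivity, fun x => min_le_left _ _, fun x => min_le_right _ _, ?_⟩
  intro x hx
  exact le_min (hgen lam S1 hS1 le_rfl (by linarith) (le_max_left _ _) H1 x hx)
    (hgen (2 * n) S2 hS2 (by linarith) le_rfl (le_max_right _ _) H2 x hx)
theorem aux_slice_deriv {n : ℕ} {B : ℂ × EuclideanSpace ℝ (Fin n) → ℂ}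
    (hB : ContDiff ℝ (⊤ : ℕ∞) B) (w : ℂ) (k : ℕ) (η : EuclideanSpace ℝ (Fin n)) :
    ‖iteratedFDeriv ℝ k (fun ξ => B (w, ξ)) η‖ ≤ ‖iteratedFDeriv ℝ k B (w, η)‖ := by
  set L : EuclideanSpace ℝ (Fin n) →L[ℝ] ℂ × EuclideanSpace ℝ (Fin n) :=
    ContinuousLinearMap.inr ℝ ℂ (EuclideanSpace ℝ (Fin n)) with hL
  set B' : ℂ × EuclideanSpace ℝ (Fin n) → ℂ := fun z => B ((w, 0) + z) with hB'
  have hB's : ContDiff ℝ (⊤ : ℕ∞) B' := hB.comp (contDiff_const.add contDiff_id)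
  have e : (fun ξ => B (w, ξ)) = B' ∘ L := by
    ext ξ; simp [hB', hL]
  rw [e, ContinuousLinearMap.iteratedFDeriv_comp_right L hB's η (i := k) (by exact_mod_cast le_top)]
  refine (ContinuousMultilinearMap.norm_compContinuousLinearMap_le _ _).trans ?_
  have e2 : iteratedFDeriv ℝ k B' (L η) = iteratedFDeriv ℝ k B (w, η) := by
    rw [hB', iteratedFDeriv_comp_add_left]
    simp [hL]
  rw [e2]
  have : ∏ _i : Fin k, ‖L‖ ≤ 1 := by
    apply Finset.prod_le_one
    · intro i _; exact norm_nonneg _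
    · intro i _; exact ContinuousLinearMap.norm_inr_le_one ℝ ℂ _
  calc _ ≤ ‖iteratedFDeriv ℝ k B (w, η)‖ * 1 := by gcongr
    _ = _ := mul_one _

theorem aux_decay1 {n : ℕ} {B : ℂ × EuclideanSpace ℝ (Fin n) → ℂ}
    (hB : ContDiff ℝ (⊤ : ℕ∞) B) (hBc : HasCompactSupport B) (N : ℕ) :
    ∃ D : ℝ, 0 ≤ D ∧ ∀ (w : ℂ) (y : EuclideanSpace ℝ (Fin n)),
      ‖y‖ ^ N * ‖∫ ξ, Complex.exp (Complex.I * (⟪y, ξ⟫ : ℂ)) * B (w, ξ)‖ ≤ D := by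
  have hbd : ∀ k : ℕ, ∃ M : ℝ, ∀ z, ‖iteratedFDeriv ℝ k B z‖ ≤ M := by
    intro k
    exact (hBc.iteratedFDeriv k).exists_bound_of_continuous
      (hB.continuous_iteratedFDeriv (m := k) (by exact_mod_cast le_top))
  choose M hM using hbd
  have hM0 : ∀ k, 0 ≤ M k := fun k => (norm_nonneg _).trans (hM k 0)
  set K : Set (EuclideanSpace ℝ (Fin n)) := Prod.snd '' tsupport B with hK
  have hKc : IsCompact K := hBc.isCompact.image continuous_snd
  have hsl : ∀ w, ContDiff ℝ (⊤ : ℕ∞) (fun ξ => B (w, ξ)) := fun w =>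
    hB.comp (contDiff_const.prodMk contDiff_id)
  have hsupp : ∀ w, tsupport (fun ξ => B (w, ξ)) ⊆ K := by
    intro w
    apply closure_minimal _ hKc.isClosed
    intro ξ hξ
    exact ⟨(w, ξ), subset_tsupport _ hξ, rfl⟩
  have hcs : ∀ w, HasCompactSupport (fun ξ => B (w, ξ)) := fun w =>
    HasCompactSupport.of_support_subset_isCompact hKc ((subset_tsupport _).trans (hsupp w))
  have hdcont : ∀ w (k : ℕ), Continuous (iteratedFDeriv ℝ k (fun ξ => B (w, ξ))) := fun w k =>
    (hsl w).continuous_iteratedFDeriv (m := k) (by exact_mod_cast le_top)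
  have hInt : ∀ w (j k : ℕ), Integrable fun v => ‖v‖ ^ j * ‖iteratedFDeriv ℝ k (fun ξ => B (w, ξ)) v‖ := by
    intro w j k
    apply Continuous.integrable_of_hasCompactSupport
    · have := hdcont w k
      fun_prop
    · exact ((hcs w).iteratedFDeriv k).norm.mul_left
  have hKfin : volume K ≠ ∞ := hKc.measure_lt_top.ne
  have hIntb : ∀ w (k : ℕ), ∫ v, ‖iteratedFDeriv ℝ k (fun ξ => B (w, ξ)) v‖ ≤ M k * volume.real K := by
    intro w k
    have h1 : ∫ v, ‖iteratedFDeriv ℝ k (fun ξ => B (w, ξ)) v‖ =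
        ∫ v in K, ‖iteratedFDeriv ℝ k (fun ξ => B (w, ξ)) v‖ := by
      rw [setIntegral_eq_integral_of_forall_compl_eq_zero]
      intro v hv
      rw [norm_eq_zero]
      by_contra hne
      exact hv (hsupp w (support_iteratedFDeriv_subset k hne))
    rw [h1]
    calc _ ≤ ∫ v in K, M k := by
          apply setIntegral_mono_on
          · have := hInt w 0 k
            simp only [pow_zero, one_mul] at this
            exact this.integrableOn
          · exact integrableOn_const hKfin
          · exact hKc.measurableSet
          · intro v _
            exact (aux_slice_deriv hB w k v).trans (hM k _)
      _ = _ := by simp [mul_comm]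
  refine ⟨(2 * Real.pi) ^ N * (2 ^ N * ∑ k ∈ Finset.range (N + 1), M k * volume.real K), ?_, ?_⟩
  · have : ∀ k, 0 ≤ M k * volume.real K := fun k => mul_nonneg (hM0 k) measureReal_nonneg
    have := Finset.sum_nonneg (fun k (_ : k ∈ Finset.range (N + 1)) => this k)
    positivity
  intro w y
  have hF := Real.pow_mul_norm_iteratedFDeriv_fourier_le (K := 0) (N := (⊤ : ℕ∞)) (hsl w)
    (fun j k _ _ => hInt w j k) (k := 0) (n := N) le_rfl (by exact_mod_cast le_top) (-(2 * Real.pi)⁻¹ • y)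
  have hfe : FourierTransform.fourier (fun ξ => B (w, ξ)) (-(2 * Real.pi)⁻¹ • y) =
      ∫ ξ, Complex.exp (Complex.I * (⟪y, ξ⟫ : ℂ)) * B (w, ξ) := by
    rw [Real.fourier_eq']
    congr 1; ext ξ
    rw [smul_eq_mul]
    congr 2
    rw [inner_smul_right, real_inner_comm]
    have : (-2 * Real.pi * (-(2 * Real.pi)⁻¹ * ⟪y, ξ⟫)) = ⟪y, ξ⟫ := by
      field_simp
    rw [this, mul_comm]
  rw [norm_iteratedFDeriv_zero, hfe, norm_smul] at hF
  simp only [Finset.range_one, zero_add, pow_zero, one_mul, Nat.cast_zero, mul_zero] at hF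
  rw [Finset.sum_product] at hF
  simp only [Finset.sum_singleton, pow_zero, one_mul] at hF
  have hnorm : ‖-(2 * Real.pi)⁻¹‖ = (2 * Real.pi)⁻¹ := by
    rw [norm_neg, Real.norm_of_nonneg (by positivity)]
  rw [hnorm, mul_pow, inv_pow, mul_assoc, inv_mul_le_iff₀ (by positivity)] at hF
  refine hF.trans ?_
  gcongr
  exact hIntb w _

theorem aux_decay {n : ℕ} (hn : 2 ≤ n) {B : ℂ × EuclideanSpace ℝ (Fin n) → ℂ}
    (hB : ContDiff ℝ (⊤ : ℕ∞) B) (hBc : HasCompactSupport B) :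
    ∃ C : ℝ, 0 < C ∧ ∀ (w : ℂ) (y : EuclideanSpace ℝ (Fin n)), y ≠ 0 →
      ‖∫ ξ, Complex.exp (Complex.I * (⟪y, ξ⟫ : ℂ)) * B (w, ξ)‖ ≤ C * min 1 (‖y‖ ^ (-(4 * n : ℝ))) := by
  obtain ⟨D0, hD0, H0⟩ := aux_decay1 hB hBc 0
  obtain ⟨D1, hD1, H1⟩ := aux_decay1 hB hBc (4 * n)
  refine ⟨D0 + D1 + 1, by positivity, fun w y hy => ?_⟩
  have hy0 : 0 < ‖y‖ := norm_pos_iff.2 hy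
  have a0 := H0 w y
  have a1 := H1 w y
  rw [pow_zero, one_mul] at a0
  rw [mul_min_of_nonneg _ _ (by positivity), mul_one]
  refine le_min (by linarith) ?_
  have e : ‖y‖ ^ (-(4 * n : ℝ)) = (‖y‖ ^ (4 * n))⁻¹ := by
    rw [Real.rpow_neg hy0.le, ← Real.rpow_natCast]; push_cast; rfl
  rw [e, ← div_eq_mul_inv, le_div_iff₀ (by positivity), mul_comm]
  linarith

theorem aux_conv_formula {n : ℕ} {a : EuclideanSpace ℝ (Fin n) → ℂ} (ha : Integrable a)
    (hac : Continuous a)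
    (f : SchwartzMap (EuclideanSpace ℝ (Fin n)) ℂ) (x : EuclideanSpace ℝ (Fin n)) :
    ‖∫ ξ, Complex.exp (Complex.I * (⟪x, ξ⟫ : ℂ)) * (a ξ * FT f ξ)‖ₑ ≤
      ∫⁻ y, ‖∫ ξ, Complex.exp (Complex.I * (⟪x - y, ξ⟫ : ℂ)) * a ξ‖ₑ * ‖f y‖ₑ := by
  have h1 : ∫ ξ, Complex.exp (Complex.I * (⟪x, ξ⟫ : ℂ)) * (a ξ * FT f ξ) =
      ∫ y, (∫ ξ, Complex.exp (Complex.I * (⟪x - y, ξ⟫ : ℂ)) * a ξ) * f y := by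
    have e1 : ∀ ξ, Complex.exp (Complex.I * (⟪x, ξ⟫ : ℂ)) * (a ξ * FT f ξ) =
        ∫ y, Complex.exp (Complex.I * (⟪x - y, ξ⟫ : ℂ)) * a ξ * f y := by
      intro ξ
      rw [FT, ← mul_assoc, ← integral_const_mul]
      congr 1; ext y
      have : Complex.exp (Complex.I * (⟪x - y, ξ⟫ : ℂ)) =
          Complex.exp (Complex.I * (⟪x, ξ⟫ : ℂ)) * Complex.exp (-Complex.I * (⟪y, ξ⟫ : ℂ)) := by
        rw [← Complex.exp_add, inner_sub_left]; push_cast; congr 1; ring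
      rw [this]; ring
    simp_rw [e1]
    rw [integral_integral_swap]
    · congr 1; ext y
      rw [integral_mul_const]
    · have hp : Integrable (fun z : EuclideanSpace ℝ (Fin n) × EuclideanSpace ℝ (Fin n) => a z.1 * f z.2)
          (volume.prod volume) := ha.mul_prod f.integrable
      refine Integrable.mono hp ?_ (Filter.Eventually.of_forall fun z => ?_)
      · apply Continuous.aestronglyMeasurable
        have := f.continuous
        fun_prop
      · simp only [Function.uncurry, norm_mul]
        rw [mul_comm Complex.I, Complex.norm_exp_ofReal_mul_I, one_mul]
  rw [h1]
  refine (enorm_integral_le_lintegral_enorm _).trans (le_of_eq ?_)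
  congr 1; ext y
  rw [enorm_mul]
theorem aux_Pf_facts {n m : ℕ} (P : MvPolynomial (Fin n) ℝ) (hhom : P.IsHomogeneous m)
    (Pf : EuclideanSpace ℝ (Fin n) → ℝ)
    (hPf : ∀ ξ, Pf ξ = MvPolynomial.eval (fun i => ξ i) P) :
    ContDiff ℝ (⊤ : ℕ∞) Pf ∧ ∀ (t : ℝ) ξ, Pf (t • ξ) = t ^ m * Pf ξ := by
  constructor
  · have e : Pf = fun ξ => ∑ d ∈ P.support, MvPolynomial.coeff d P * ∏ i, (ξ i) ^ d i := by
      ext ξ; rw [hPf, MvPolynomial.eval_eq']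
    rw [e]
    apply ContDiff.sum
    intro d _
    apply contDiff_const.mul
    apply contDiff_prod
    intro i _
    apply ContDiff.pow
    exact (EuclideanSpace.proj (𝕜 := ℝ) i).contDiff
  · intro t ξ
    rw [hPf, hPf, MvPolynomial.eval_eq', MvPolynomial.eval_eq', Finset.mul_sum]
    apply Finset.sum_congr rfl
    intro d hd
    have hdeg := hhom (MvPolynomial.mem_support_iff.1 hd)
    have : ∑ i, d i = m := by
      rw [← hdeg, Finsupp.weight_apply, Finsupp.sum_fintype] <;> simp
    rw [← this, ← Finset.prod_pow_eq_pow_sum]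
    simp only [PiLp.smul_apply, smul_eq_mul, mul_pow, Finset.prod_mul_distrib]
    ring

theorem aux_coercive {n m : ℕ} (hn : 2 ≤ n) (hm : 2 ≤ m) {Pf : EuclideanSpace ℝ (Fin n) → ℝ}
    (hc : Continuous Pf) (hh : ∀ (t : ℝ) ξ, Pf (t • ξ) = t ^ m * Pf ξ)
    (hell : ∀ ξ : EuclideanSpace ℝ (Fin n), ξ ≠ 0 → 0 < Pf ξ) (K : ℝ) :
    ∃ R : ℝ, ∀ ξ, Pf ξ ≤ K → ‖ξ‖ ≤ R := by
  haveI : Nonempty (Fin n) := ⟨⟨0, by omega⟩⟩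
  have hne : (Metric.sphere (0 : EuclideanSpace ℝ (Fin n)) 1).Nonempty :=
    NormedSpace.sphere_nonempty.2 zero_le_one
  obtain ⟨x0, hx0, hmin⟩ := (isCompact_sphere (0 : EuclideanSpace ℝ (Fin n)) 1).exists_isMinOn hne
    hc.continuousOn
  have hx0n : ‖x0‖ = 1 := by simpa using hx0
  have hcpos : 0 < Pf x0 := hell x0 (by intro h; simp [h] at hx0n)
  refine ⟨max 1 (K / Pf x0), fun ξ hξ => ?_⟩
  by_cases h1 : ‖ξ‖ ≤ 1
  · exact h1.trans (le_max_left _ _)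
  push Not at h1
  have h0 : 0 < ‖ξ‖ := by linarith
  apply le_max_of_le_right
  rw [le_div_iff₀ hcpos]
  have hs : ‖ξ‖⁻¹ • ξ ∈ Metric.sphere (0 : EuclideanSpace ℝ (Fin n)) 1 := by
    simp [norm_smul, h0.ne']
  have hle : Pf x0 ≤ Pf (‖ξ‖⁻¹ • ξ) := hmin hs
  have e : Pf ξ = ‖ξ‖ ^ m * Pf (‖ξ‖⁻¹ • ξ) := by
    rw [← hh, smul_smul, mul_inv_cancel₀ h0.ne', one_smul]
  calc ‖ξ‖ * Pf x0 ≤ ‖ξ‖ ^ m * Pf (‖ξ‖⁻¹ • ξ) := by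
        gcongr
        exact le_self_pow₀ h1.le (by omega)
    _ ≤ K := by rw [← e]; exact hξ

theorem aux_symbol {n m : ℕ} (hn : 2 ≤ n) (hm : 2 ≤ m) {Pf : EuclideanSpace ℝ (Fin n) → ℝ}
    (hs : ContDiff ℝ (⊤ : ℕ∞) Pf) (hh : ∀ (t : ℝ) ξ, Pf (t • ξ) = t ^ m * Pf ξ)
    (hell : ∀ ξ : EuclideanSpace ℝ (Fin n), ξ ≠ 0 → 0 < Pf ξ)
    {ψ : ℝ → ℝ} (hψ : ContDiff ℝ (⊤ : ℕ∞) ψ)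
    (hψ1 : ∀ s ∈ Set.Icc (-2 : ℝ) 2, ψ s = 1)
    (hψs : tsupport ψ ⊆ Set.Icc (-4 : ℝ) 4) (α : ℝ) {ρ : ℝ} (hρ : 0 < ρ) (hρ2 : ρ < 2 ^ m) :
    ∃ B : ℂ × EuclideanSpace ℝ (Fin n) → ℂ, ContDiff ℝ (⊤ : ℕ∞) B ∧ HasCompactSupport B ∧
      ∀ w η, ‖w‖ ≤ ρ → B (w, η) =
        ((ψ (Pf η ^ ((1 : ℝ) / m) / 2) - ψ (Pf η ^ ((1 : ℝ) / m)) : ℝ) : ℂ) *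
          ((Pf η : ℂ) - w) ^ (-(α : ℂ)) := by
  have hm0 : (m : ℝ) ≠ 0 := by positivity
  have hP0 : ∀ ξ, 0 ≤ Pf ξ := by
    intro ξ
    by_cases h : ξ = 0
    · have := hh 0 0
      rw [zero_pow (by omega), zero_mul, zero_smul] at this
      rw [h, this]
    · exact (hell ξ h).le
  let χ : ContDiffBump (0 : ℂ) := ⟨ρ, (ρ + 2 ^ m) / 2, hρ, by linarith⟩
  set B : ℂ × EuclideanSpace ℝ (Fin n) → ℂ := fun z => (χ z.1 : ℂ) *
    (((ψ (Pf z.2 ^ ((1 : ℝ) / m) / 2) - ψ (Pf z.2 ^ ((1 : ℝ) / m)) : ℝ) : ℂ) *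
          ((Pf z.2 : ℂ) - z.1) ^ (-(α : ℂ))) with hB
  have hφ0 : ∀ η, Pf η ≤ 2 ^ m → ψ (Pf η ^ ((1 : ℝ) / m) / 2) - ψ (Pf η ^ ((1 : ℝ) / m)) = 0 := by
    intro η hη
    have h1 : 0 ≤ Pf η ^ ((1 : ℝ) / m) := Real.rpow_nonneg (hP0 η) _
    have h2 : Pf η ^ ((1 : ℝ) / m) ≤ 2 := by
      calc Pf η ^ ((1 : ℝ) / m) ≤ ((2 : ℝ) ^ m) ^ ((1 : ℝ) / m) := by gcongr; exact hP0 η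
        _ = 2 := by rw [one_div, Real.pow_rpow_inv_natCast (by norm_num) (by omega)]
    rw [hψ1 _ ⟨by linarith, by linarith⟩, hψ1 _ ⟨by linarith, h2⟩, sub_self]
  refine ⟨B, ?_, ?_, ?_⟩
  · rw [contDiff_iff_contDiffAt]
    rintro ⟨w, η⟩
    by_cases h1 : Pf η < 2 ^ m
    · have : B =ᶠ[nhds (w, η)] fun _ => 0 := by
        have ho : IsOpen {z : ℂ × EuclideanSpace ℝ (Fin n) | Pf z.2 < 2 ^ m} :=
          isOpen_lt (hs.continuous.comp continuous_snd) continuous_const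
        filter_upwards [ho.mem_nhds h1] with z hz
        simp only [hB]
        rw [hφ0 z.2 (le_of_lt hz)]; simp
      exact contDiffAt_const.congr_of_eventuallyEq this
    by_cases h2 : (ρ + 2 ^ m) / 2 < ‖w‖
    · have : B =ᶠ[nhds (w, η)] fun _ => 0 := by
        have ho : IsOpen {z : ℂ × EuclideanSpace ℝ (Fin n) | (ρ + 2 ^ m) / 2 < ‖z.1‖} :=
          isOpen_lt continuous_const (continuous_norm.comp continuous_fst)
        filter_upwards [ho.mem_nhds h2] with z hz
        simp only [hB]
        rw [χ.zero_of_le_dist]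
        · simp
        · rw [dist_zero_right]; exact le_of_lt hz
      exact contDiffAt_const.congr_of_eventuallyEq this
    push Not at h1 h2
    have hpos : 0 < Pf η := lt_of_lt_of_le (by positivity) h1
    have hPs : ContDiffAt ℝ (⊤ : ℕ∞) (fun z : ℂ × EuclideanSpace ℝ (Fin n) => Pf z.2) (w, η) :=
      (hs.comp contDiff_snd).contDiffAt
    have hPr : ContDiffAt ℝ (⊤ : ℕ∞)
        (fun z : ℂ × EuclideanSpace ℝ (Fin n) => Pf z.2 ^ ((1 : ℝ) / m)) (w, η) :=
      hPs.rpow_const_of_ne hpos.ne'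
    have hof : ContDiff ℝ (⊤ : ℕ∞) (fun t : ℝ => (t : ℂ)) := Complex.ofRealCLM.contDiff
    have hc1 : ContDiffAt ℝ (⊤ : ℕ∞) (fun z : ℂ × EuclideanSpace ℝ (Fin n) => (χ z.1 : ℂ)) (w, η) :=
      (hof.comp (χ.contDiff.comp contDiff_fst)).contDiffAt
    have hc2 : ContDiffAt ℝ (⊤ : ℕ∞) (fun z : ℂ × EuclideanSpace ℝ (Fin n) =>
        ((ψ (Pf z.2 ^ ((1 : ℝ) / m) / 2) - ψ (Pf z.2 ^ ((1 : ℝ) / m)) : ℝ) : ℂ)) (w, η) := by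
      refine hof.contDiffAt.comp (w, η) (ContDiffAt.sub ?_ ?_)
      · exact hψ.contDiffAt.comp (w, η) (hPr.div_const 2)
      · exact hψ.contDiffAt.comp (w, η) hPr
    have hslit : (Pf η : ℂ) - w ∈ Complex.slitPlane := by
      left
      have := Complex.re_le_norm w
      simp only [Complex.sub_re, Complex.ofReal_re]
      linarith
    have hc3 : ContDiffAt ℝ (⊤ : ℕ∞) (fun z : ℂ × EuclideanSpace ℝ (Fin n) =>
        ((Pf z.2 : ℂ) - z.1) ^ (-(α : ℂ))) (w, η) := by
      have ha : ContDiffAt ℂ (⊤ : ℕ∞) (fun v : ℂ => v ^ (-(α : ℂ))) ((Pf η : ℂ) - w) :=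
        (analyticAt_id.cpow analyticAt_const hslit).contDiffAt
      have hin : ContDiffAt ℝ (⊤ : ℕ∞) (fun z : ℂ × EuclideanSpace ℝ (Fin n) =>
        ((Pf z.2 : ℂ) - z.1)) (w, η) :=
        (hof.contDiffAt.comp (w, η) hPs).sub contDiffAt_fst
      exact (ha.restrict_scalars ℝ).comp (w, η) hin
    exact hc1.mul (hc2.mul hc3)
  · obtain ⟨R, hR⟩ := aux_coercive hn hm hs.continuous hh hell (8 ^ m)
    apply HasCompactSupport.of_support_subset_isCompact
      ((isCompact_closedBall (0 : ℂ) ((ρ + 2 ^ m) / 2)).prod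
        (isCompact_closedBall (0 : EuclideanSpace ℝ (Fin n)) R))
    rintro ⟨w, η⟩ hz
    rw [Function.mem_support] at hz
    simp only [hB] at hz
    constructor
    · simp only [mem_closedBall_zero_iff]
      by_contra hcon
      push Not at hcon
      apply hz
      rw [χ.zero_of_le_dist]
      · simp
      · rw [dist_zero_right]; exact le_of_lt hcon
    · simp only [mem_closedBall_zero_iff]
      apply hR
      by_contra hcon
      push Not at hcon
      apply hz
      have h8 : 8 < Pf η ^ ((1 : ℝ) / m) := by
        calc (8 : ℝ) = ((8 : ℝ) ^ m) ^ ((1 : ℝ) / m) := by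
              rw [one_div, Real.pow_rpow_inv_natCast (by norm_num) (by omega)]
          _ < _ := by
              apply Real.rpow_lt_rpow (by positivity) hcon
              positivity
      have hz4 : ∀ s, 4 < s → ψ s = 0 := by
        intro s hs
        by_contra hne
        exact absurd (hψs (subset_tsupport _ hne)).2 (by push Not; exact hs)
      rw [hz4 _ (by linarith), hz4 _ (by linarith)]
      simp
  · intro w η hw
    simp only [hB]
    rw [χ.one_of_mem_closedBall]
    · simp
    · simpa using hw

theorem aux_FT_integrable {n : ℕ} (f : SchwartzMap (EuclideanSpace ℝ (Fin n)) ℂ) :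
    Integrable (FT f) ∧ Continuous (FT f) := by
  have e : FT f = fun ξ => (FourierTransform.fourier f) ((2 * Real.pi)⁻¹ • ξ) := by
    ext ξ
    rw [SchwartzMap.fourier_coe, Real.fourier_eq', FT]
    congr 1; ext x
    rw [smul_eq_mul]
    congr 2
    rw [inner_smul_right]
    have : (-2 * Real.pi * ((2 * Real.pi)⁻¹ * ⟪x, ξ⟫)) = -⟪x, ξ⟫ := by
      field_simp
    rw [this]; push_cast; ring
  rw [e]
  constructor
  · exact (FourierTransform.fourier f).integrable.comp_smul (by positivity)
  · exact (FourierTransform.fourier f).continuous.comp (continuous_const_smul _)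

theorem aux_piece {n m : ℕ} {B : ℂ × EuclideanSpace ℝ (Fin n) → ℂ} {C : ℝ}
    (hC : ∀ (w : ℂ) (y : EuclideanSpace ℝ (Fin n)), y ≠ 0 →
      ‖∫ ξ, Complex.exp (Complex.I * (⟪y, ξ⟫ : ℂ)) * B (w, ξ)‖ ≤ C * min 1 (‖y‖ ^ (-(4 * n : ℝ))))
    {T : ℝ} (hT : 0 < T) (α : ℝ) (w : ℂ) (y : EuclideanSpace ℝ (Fin n)) (hy : y ≠ 0) :
    ‖∫ ξ, Complex.exp (Complex.I * (⟪y, ξ⟫ : ℂ)) *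
        (((T ^ (-((m : ℝ) * α)) : ℝ) : ℂ) * B (w, T⁻¹ • ξ))‖ ≤
      C * T ^ ((n : ℝ) - m * α) * min 1 ((T * ‖y‖) ^ (-(4 * n : ℝ))) := by
  have e : ∀ ξ : EuclideanSpace ℝ (Fin n), Complex.exp (Complex.I * (⟪y, ξ⟫ : ℂ)) *
        (((T ^ (-((m : ℝ) * α)) : ℝ) : ℂ) * B (w, T⁻¹ • ξ)) =
      ((T ^ (-((m : ℝ) * α)) : ℝ) : ℂ) * (fun η => Complex.exp (Complex.I * (⟪T • y, η⟫ : ℂ)) *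
        B (w, η)) (T⁻¹ • ξ) := by
    intro ξ
    dsimp only
    rw [inner_smul_left, inner_smul_right]
    have : (starRingEnd ℝ) T * (T⁻¹ * ⟪y, ξ⟫) = ⟪y, ξ⟫ := by
      simp [hT.ne']
    rw [this]; ring
  simp_rw [e]
  rw [integral_const_mul, Measure.integral_comp_smul volume
    (fun η => Complex.exp (Complex.I * (⟪T • y, η⟫ : ℂ)) * B (w, η)) T⁻¹, norm_mul, norm_smul]
  have h := hC w (T • y) (smul_ne_zero hT.ne' hy)
  rw [norm_smul, Real.norm_of_nonneg hT.le] at h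
  rw [Complex.norm_of_nonneg (by positivity), finrank_euclideanSpace_fin, inv_pow, inv_inv,
    Real.norm_of_nonneg (abs_nonneg _), abs_of_nonneg (by positivity), sub_eq_neg_add,
    Real.rpow_add hT, Real.rpow_natCast]
  calc _ ≤ T ^ (-((m : ℝ) * α)) * (T ^ n * (C * min 1 ((T * ‖y‖) ^ (-(4 * n : ℝ))))) := by gcongr
    _ = _ := by ring

theorem aux_pointwise {n : ℕ} {C lam : ℝ} (hn : 2 ≤ n)
    {κ : EuclideanSpace ℝ (Fin n) → ℝ≥0∞}
    (hκ : ∀ x, x ≠ 0 → ∑' j : ℕ, ENNReal.ofReal (C * ((2 : ℝ) ^ j) ^ lam *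
      min 1 ((2 ^ j * ‖x‖) ^ (-(4 * n : ℝ)))) ≤ κ x)
    {a : ℕ → EuclideanSpace ℝ (Fin n) → ℂ} {b : EuclideanSpace ℝ (Fin n) → ℂ} {M : ℝ}
    (hai : ∀ j, Integrable (a j)) (hac : ∀ j, Continuous (a j))
    (hK : ∀ j y, y ≠ 0 → ‖∫ ξ, Complex.exp (Complex.I * (⟪y, ξ⟫ : ℂ)) * a j ξ‖ ≤
      C * ((2 : ℝ) ^ j) ^ lam * min 1 ((2 ^ j * ‖y‖) ^ (-(4 * n : ℝ))))
    (hM : ∀ J ξ, ‖∑ j ∈ Finset.range J, a j ξ‖ ≤ M)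
    (hlim : ∀ ξ, Filter.Tendsto (fun J => ∑ j ∈ Finset.range J, a j ξ) Filter.atTop (nhds (b ξ)))
    (f : SchwartzMap (EuclideanSpace ℝ (Fin n)) ℂ) (x : EuclideanSpace ℝ (Fin n)) :
    ‖IFT (fun ξ => b ξ * FT f ξ) x‖ₑ ≤ ∫⁻ y, κ (x - y) * ‖f y‖ₑ := by
  haveI : Nonempty (Fin n) := ⟨⟨0, by omega⟩⟩
  obtain ⟨hFi, hFc⟩ := aux_FT_integrable f
  have hexp : ∀ ξ : EuclideanSpace ℝ (Fin n), ‖Complex.exp (Complex.I * (⟪x, ξ⟫ : ℂ))‖ = 1 := by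
    intro ξ
    rw [mul_comm Complex.I, Complex.norm_exp_ofReal_mul_I]
  have hM0 : 0 ≤ M := (norm_nonneg _).trans (hM 0 0)
  -- the single-scale integrands
  have hji : ∀ j, Integrable fun ξ => Complex.exp (Complex.I * (⟪x, ξ⟫ : ℂ)) * (a j ξ * FT f ξ) := by
    intro j
    have hb : ∀ ξ, ‖a j ξ‖ ≤ M + M := by
      intro ξ
      have : a j ξ = ∑ i ∈ Finset.range (j + 1), a i ξ - ∑ i ∈ Finset.range j, a i ξ := by
        rw [Finset.sum_range_succ]; ring
      rw [this]
      exact (norm_sub_le _ _).trans (add_le_add (hM _ _) (hM _ _))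
    refine Integrable.mono' (hFi.norm.const_mul (M + M)) ?_ (Filter.Eventually.of_forall fun ξ => ?_)
    · apply Continuous.aestronglyMeasurable
      have := hac j
      fun_prop
    · rw [norm_mul, hexp, one_mul, norm_mul]
      gcongr
      exact hb ξ
  have hsum : ∀ J, ∫ ξ, Complex.exp (Complex.I * (⟪x, ξ⟫ : ℂ)) *
      ((∑ j ∈ Finset.range J, a j ξ) * FT f ξ) =
      ∑ j ∈ Finset.range J, ∫ ξ, Complex.exp (Complex.I * (⟪x, ξ⟫ : ℂ)) * (a j ξ * FT f ξ) := by
    intro J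
    rw [← integral_finsetSum _ (fun j _ => hji j)]
    congr 1; ext ξ
    rw [Finset.sum_mul, Finset.mul_sum]
  have hconv : Filter.Tendsto (fun J => ∫ ξ, Complex.exp (Complex.I * (⟪x, ξ⟫ : ℂ)) *
      ((∑ j ∈ Finset.range J, a j ξ) * FT f ξ)) Filter.atTop
      (nhds (∫ ξ, Complex.exp (Complex.I * (⟪x, ξ⟫ : ℂ)) * (b ξ * FT f ξ))) := by
    refine tendsto_integral_of_dominated_convergence (fun ξ => M * ‖FT f ξ‖) ?_
      (hFi.norm.const_mul M) ?_ ?_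
    · intro J
      apply Continuous.aestronglyMeasurable
      have : Continuous fun ξ => ∑ j ∈ Finset.range J, a j ξ := continuous_finset_sum _ fun j _ => hac j
      fun_prop
    · intro J
      refine Filter.Eventually.of_forall fun ξ => ?_
      rw [norm_mul, hexp, one_mul, norm_mul]
      gcongr
      exact hM J ξ
    · refine Filter.Eventually.of_forall fun ξ => ?_
      exact ((hlim ξ).mul_const _).const_mul _
  have hbd : ∀ J, ‖∫ ξ, Complex.exp (Complex.I * (⟪x, ξ⟫ : ℂ)) *
      ((∑ j ∈ Finset.range J, a j ξ) * FT f ξ)‖ₑ ≤ ∫⁻ y, κ (x - y) * ‖f y‖ₑ := by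
    intro J
    rw [hsum J]
    calc _ ≤ ∑ j ∈ Finset.range J,
          ‖∫ ξ, Complex.exp (Complex.I * (⟪x, ξ⟫ : ℂ)) * (a j ξ * FT f ξ)‖ₑ := enorm_sum_le _ _
      _ ≤ ∑ j ∈ Finset.range J, ∫⁻ y, ENNReal.ofReal (C * ((2 : ℝ) ^ j) ^ lam *
            min 1 ((2 ^ j * ‖x - y‖) ^ (-(4 * n : ℝ)))) * ‖f y‖ₑ := by
          apply Finset.sum_le_sum
          intro j _
          refine (aux_conv_formula (hai j) (hac j) f x).trans ?_
          apply lintegral_mono_ae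
          filter_upwards [Measure.ae_ne volume x] with y hy
          gcongr
          rw [← ofReal_norm]
          exact ENNReal.ofReal_le_ofReal (hK j _ (sub_ne_zero.2 (Ne.symm hy)))
      _ = ∫⁻ y, ∑ j ∈ Finset.range J, ENNReal.ofReal (C * ((2 : ℝ) ^ j) ^ lam *
            min 1 ((2 ^ j * ‖x - y‖) ^ (-(4 * n : ℝ)))) * ‖f y‖ₑ := by
          rw [lintegral_finset_sum]
          intro j _
          have := f.continuous.measurable
          fun_prop
      _ ≤ _ := by
          apply lintegral_mono_ae
          filter_upwards [Measure.ae_ne volume x] with y hy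
          rw [← Finset.sum_mul]
          gcongr
          exact (ENNReal.sum_le_tsum _).trans (hκ _ (sub_ne_zero.2 (Ne.symm hy)))
  have hmain : ‖∫ ξ, Complex.exp (Complex.I * (⟪x, ξ⟫ : ℂ)) * (b ξ * FT f ξ)‖ₑ ≤
      ∫⁻ y, κ (x - y) * ‖f y‖ₑ :=
    le_of_tendsto hconv.enorm (Filter.Eventually.of_forall hbd)
  rw [IFT, enorm_mul]
  have h1 : ‖(((2 * Real.pi) ^ n : ℝ) : ℂ)⁻¹‖ₑ ≤ 1 := by
    rw [← ofReal_norm, norm_inv, Complex.norm_of_nonneg (by positivity)]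
    rw [ENNReal.ofReal_le_one]
    apply inv_le_one_of_one_le₀
    apply one_le_pow₀
    linarith [Real.pi_gt_three]
  calc _ ≤ 1 * ‖∫ ξ, Complex.exp (Complex.I * (⟪x, ξ⟫ : ℂ)) * (b ξ * FT f ξ)‖ₑ := by gcongr
    _ ≤ _ := by rw [one_mul]; exact hmain

theorem aux_cpow_scale {r : ℝ} (hr : 0 < r) (w : ℂ) {α : ℝ} (hα : 0 < α) :
    ((r : ℂ) * w) ^ (-(α : ℂ)) = ((r ^ (-α) : ℝ) : ℂ) * w ^ (-(α : ℂ)) := by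
  have hα' : (-(α : ℂ)) ≠ 0 := by
    simp [hα.ne']
  by_cases hw : w = 0
  · simp [hw, Complex.zero_cpow hα', hα.ne']
  have hr' : (r : ℂ) ≠ 0 := by exact_mod_cast hr.ne'
  rw [Complex.cpow_def_of_ne_zero (mul_ne_zero hr' hw), Complex.cpow_def_of_ne_zero hw,
    Complex.log_ofReal_mul hr hw, Complex.ofReal_cpow hr.le, Complex.cpow_def_of_ne_zero hr',
    ← Complex.exp_add, Complex.ofReal_log hr.le]
  congr 1
  push_cast
  ring

/-- `L^p → L^q` bounds, uniform in `ε`, for the Fourier multiplier with symbol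
`a_ε(ξ) = (1 − ψ(P(ξ)^{1/m})) (P(ξ) − (1+iε)^m)^{−α}` when `mα < n`. -/
theorem statement7
    (n m : ℕ) (hn : 2 ≤ n) (hm : 2 ≤ m)
    (P : MvPolynomial (Fin n) ℝ) (hhom : P.IsHomogeneous m)
    (Pf : EuclideanSpace ℝ (Fin n) → ℝ)
    (hPf : ∀ ξ, Pf ξ = MvPolynomial.eval (fun i => ξ i) P)
    (hell : ∀ ξ : EuclideanSpace ℝ (Fin n), ξ ≠ 0 → 0 < Pf ξ)
    (hnd : ∀ ξ : EuclideanSpace ℝ (Fin n), ξ ≠ 0 → HessDet Pf ξ ≠ 0)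
    (ψ : ℝ → ℝ) (hψ : ContDiff ℝ (⊤ : ℕ∞) ψ) (hψc : HasCompactSupport ψ)
    (hψ1 : ∀ s ∈ Set.Icc (-2 : ℝ) 2, ψ s = 1)
    (hψs : tsupport ψ ⊆ Set.Icc (-4 : ℝ) 4)
    (α : ℝ) (hα : 0 < α) (hαn : (m : ℝ) * α < n)
    (p q : ℝ≥0∞) (hp : 1 ≤ p) (hpq : p ≤ q)
    (hup : (1/p).toReal - (1/q).toReal ≤ (m : ℝ) * α / (n : ℝ))
    (hex1 : ¬(p = ENNReal.ofReal ((n : ℝ) / ((m : ℝ) * α)) ∧ q = ∞))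
    (hex2 : ¬(p = 1 ∧ q = ENNReal.ofReal ((n : ℝ) / ((n : ℝ) - (m : ℝ) * α)))) :
    ∃ C : ℝ, 0 < C ∧ ∀ ε : ℝ, ε ∈ Set.Ioc (0 : ℝ) 1 →
      (m : ℝ) * Real.arctan ε < Real.pi →
      ∀ f : SchwartzMap (EuclideanSpace ℝ (Fin n)) ℂ,
        eLpNorm (IFT (fun ξ =>
            (((1 - ψ (Pf ξ ^ ((1 : ℝ)/m)) : ℝ) : ℂ) *
              ((Pf ξ : ℂ) - (1 + ε * Complex.I) ^ m) ^ (-(α : ℂ))) * FT (⇑f) ξ)) q volume ≤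
          ENNReal.ofReal C * eLpNorm (⇑f) p volume := by
  obtain ⟨hs, hh⟩ := aux_Pf_facts P hhom Pf hPf
  have hm0 : (m : ℝ) ≠ 0 := by positivity
  have hmα : 0 < (m : ℝ) * α := by positivity
  have hn0 : (0 : ℝ) < n := by positivity
  have hP0 : ∀ ξ, 0 ≤ Pf ξ := by
    intro ξ
    by_cases h : ξ = 0
    · have := hh 0 0
      rw [zero_pow (by omega), zero_mul, zero_smul] at this
      rw [h, this]
    · exact (hell ξ h).le
  set ρ : ℝ := ‖(1 : ℂ) + Complex.I‖ ^ m with hρdef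
  have hsq : ‖(1 : ℂ) + Complex.I‖ ^ 2 = 2 := by
    rw [← Complex.normSq_eq_norm_sq, Complex.normSq_apply]; norm_num
  have hnpos : 0 < ‖(1 : ℂ) + Complex.I‖ := by
    by_contra h
    have : ‖(1 : ℂ) + Complex.I‖ = 0 := le_antisymm (not_lt.1 h) (norm_nonneg _)
    rw [this] at hsq; norm_num at hsq
  have hρ : 0 < ρ := by positivity
  have hρ2 : ρ < 2 ^ m := by
    apply pow_lt_pow_left₀ _ hnpos.le (by omega)
    nlinarith
  obtain ⟨B, hBs, hBc, hB⟩ := aux_symbol hn hm hs hh hell hψ hψ1 hψs α hρ hρ2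
  obtain ⟨C0, hC0, hdec⟩ := aux_decay hn hBs hBc
  set lam : ℝ := (n : ℝ) - m * α with hlam
  have hl : 0 < lam := by rw [hlam]; linarith
  have hl' : lam < n := by rw [hlam]; linarith
  have hnl : (n : ℝ) - lam = m * α := by rw [hlam]; ring
  obtain ⟨κ, A, hκm, hA, hκ1, hκ2, hκ⟩ := aux_kappa_exists hn hl hl' hC0
  obtain ⟨C, hC, hmain⟩ := aux_kernel_bound hn hl hl' hκm hA hκ1 hκ2 p q hp hpq
    (by rw [hnl]; exact hup) (by rw [hnl]; exact hex1) hex2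
  obtain ⟨S, hS⟩ := hψc.exists_bound_of_continuous hψ.continuous
  have hS0 : 0 ≤ S := (norm_nonneg _).trans (hS 0)
  refine ⟨C, hC, fun ε hε _ f => hmain f _ fun x => ?_⟩
  set z : ℂ := (1 + ε * Complex.I) ^ m with hz
  have hzρ : ‖z‖ ≤ ρ := by
    rw [hz, norm_pow]
    apply pow_le_pow_left₀ (norm_nonneg _)
    apply le_of_sq_le_sq _ (norm_nonneg _)
    rw [hsq, ← Complex.normSq_eq_norm_sq, Complex.normSq_apply]
    have h1 := hε.1
    have h2 := hε.2
    simp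
    nlinarith
  -- the dyadic pieces
  set a : ℕ → EuclideanSpace ℝ (Fin n) → ℂ := fun j ξ =>
    ((((2 : ℝ) ^ j) ^ (-((m : ℝ) * α)) : ℝ) : ℂ) *
      B (((((2 : ℝ) ^ j) ^ m)⁻¹ : ℝ) * z, ((2 : ℝ) ^ j)⁻¹ • ξ) with ha
  have haf : ∀ j ξ, a j ξ = ((ψ (Pf ξ ^ ((1 : ℝ) / m) / 2 ^ (j + 1)) : ℂ) -
      (ψ (Pf ξ ^ ((1 : ℝ) / m) / 2 ^ j) : ℂ)) * ((Pf ξ : ℂ) - z) ^ (-(α : ℂ)) := by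
    intro j ξ
    have hT : (0 : ℝ) < 2 ^ j := by positivity
    have hT1 : (1 : ℝ) ≤ 2 ^ j := one_le_pow₀ (by norm_num)
    generalize hTd : (2 : ℝ) ^ j = T at hT hT1
    have hw : ‖(((T ^ m)⁻¹ : ℝ) : ℂ) * z‖ ≤ ρ := by
      rw [norm_mul, Complex.norm_of_nonneg (by positivity)]
      calc _ ≤ 1 * ‖z‖ := by
            gcongr
            exact inv_le_one_of_one_le₀ (one_le_pow₀ hT1)
        _ ≤ ρ := by rw [one_mul]; exact hzρ
    simp only [ha]
    rw [hTd, hB _ _ hw, hh, inv_pow]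
    have e1 : ((T ^ m)⁻¹ * Pf ξ) ^ ((1 : ℝ) / m) = Pf ξ ^ ((1 : ℝ) / m) / T := by
      rw [Real.mul_rpow (by positivity) (hP0 ξ), Real.inv_rpow (by positivity), one_div,
        Real.pow_rpow_inv_natCast hT.le (by omega)]
      field_simp
    have e2 : (((T ^ m)⁻¹ * Pf ξ : ℝ) : ℂ) - (((T ^ m)⁻¹ : ℝ) : ℂ) * z =
        (((T ^ m)⁻¹ : ℝ) : ℂ) * ((Pf ξ : ℂ) - z) := by
      rw [Complex.ofReal_mul]; ring
    have e3 : T ^ (-((m : ℝ) * α)) * ((T ^ m)⁻¹) ^ (-α) = 1 := by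
      rw [Real.inv_rpow (by positivity), Real.rpow_neg (by positivity), Real.rpow_neg (by positivity),
        inv_inv, ← Real.rpow_natCast, ← Real.rpow_mul hT.le]
      exact inv_mul_cancel₀ (by positivity)
    have e3' : ((T ^ (-((m : ℝ) * α)) : ℝ) : ℂ) * ((((T ^ m)⁻¹) ^ (-α) : ℝ) : ℂ) = 1 := by
      rw [← Complex.ofReal_mul, e3, Complex.ofReal_one]
    rw [e1, e2, aux_cpow_scale (by positivity) _ hα, pow_succ, hTd, div_div]
    push_cast at e3' ⊢
    linear_combination ((ψ (Pf ξ ^ ((1 : ℝ) / m) / (T * 2)) : ℂ) -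
      (ψ (Pf ξ ^ ((1 : ℝ) / m) / T) : ℂ)) * ((Pf ξ : ℂ) - z) ^ (-(α : ℂ)) * e3'
  have hsum : ∀ J ξ, ∑ j ∈ Finset.range J, a j ξ = ((ψ (Pf ξ ^ ((1 : ℝ) / m) / 2 ^ J) : ℂ) -
      (ψ (Pf ξ ^ ((1 : ℝ) / m)) : ℂ)) * ((Pf ξ : ℂ) - z) ^ (-(α : ℂ)) := by
    intro J ξ
    simp_rw [haf]
    rw [← Finset.sum_mul, Finset.sum_range_sub
      (fun j => (ψ (Pf ξ ^ ((1 : ℝ) / m) / 2 ^ j) : ℂ))]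
    simp
  have hac : ∀ j, Continuous (a j) := by
    intro j
    have := hBs.continuous
    simp only [ha]
    fun_prop
  have hai : ∀ j, Integrable (a j) := by
    intro j
    refine (hac j).integrable_of_hasCompactSupport ?_
    have hcs : HasCompactSupport fun ξ => B (((((2 : ℝ) ^ j) ^ m)⁻¹ : ℝ) * z, ξ) := by
      apply HasCompactSupport.of_support_subset_isCompact (hBc.isCompact.image continuous_snd)
      intro ξ hξ
      exact ⟨_, subset_tsupport _ hξ, rfl⟩
    have := hcs.comp_homeomorph (Homeomorph.smulOfNeZero (((2 : ℝ) ^ j)⁻¹) (by positivity))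
    exact this.mul_left
  refine aux_pointwise (M := 2 * S * (2 ^ m - ρ) ^ (-α)) hn hκ hai hac ?_ ?_ ?_ f x
  · intro j y hy
    exact aux_piece hdec (by positivity) α _ y hy
  · intro J ξ
    rw [hsum]
    by_cases hle : Pf ξ ≤ 2 ^ m
    · have h1 : 0 ≤ Pf ξ ^ ((1 : ℝ) / m) := Real.rpow_nonneg (hP0 ξ) _
      have h2 : Pf ξ ^ ((1 : ℝ) / m) ≤ 2 := by
        calc Pf ξ ^ ((1 : ℝ) / m) ≤ ((2 : ℝ) ^ m) ^ ((1 : ℝ) / m) := by gcongr; exact hP0 ξ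
          _ = 2 := by rw [one_div, Real.pow_rpow_inv_natCast (by norm_num) (by omega)]
      have h3 : Pf ξ ^ ((1 : ℝ) / m) / 2 ^ J ≤ Pf ξ ^ ((1 : ℝ) / m) :=
        div_le_self h1 (one_le_pow₀ (by norm_num))
      have h4 : 0 ≤ Pf ξ ^ ((1 : ℝ) / m) / 2 ^ J := by positivity
      rw [hψ1 _ ⟨by linarith, by linarith⟩, hψ1 _ ⟨by linarith, h2⟩, sub_self, zero_mul, norm_zero]
      have : 0 ≤ (2 : ℝ) ^ m - ρ := by linarith
      positivity
    · push Not at hle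
      have hge : 2 ^ m - ρ ≤ ‖(Pf ξ : ℂ) - z‖ := by
        have h1 := norm_sub_norm_le (Pf ξ : ℂ) z
        rw [Complex.norm_of_nonneg (hP0 ξ)] at h1
        linarith
      have hc : ‖((Pf ξ : ℂ) - z) ^ (-(α : ℂ))‖ ≤ (2 ^ m - ρ) ^ (-α) := by
        rw [← Complex.ofReal_neg, Complex.norm_cpow_real]
        exact Real.rpow_le_rpow_of_nonpos (by linarith) hge (by linarith)
      rw [norm_mul]
      gcongr
      refine (norm_sub_le _ _).trans ?_
      rw [Complex.norm_real, Complex.norm_real]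
      linarith [hS (Pf ξ ^ ((1 : ℝ) / m) / 2 ^ J), hS (Pf ξ ^ ((1 : ℝ) / m))]
  · intro ξ
    simp_rw [hsum]
    have ht : Filter.Tendsto (fun J : ℕ => Pf ξ ^ ((1 : ℝ) / m) / 2 ^ J) Filter.atTop (nhds 0) :=
      tendsto_const_nhds.div_atTop (tendsto_pow_atTop_atTop_of_one_lt (by norm_num))
    have h1 := (hψ.continuous.tendsto 0).comp ht
    rw [hψ1 0 (by norm_num)] at h1
    have h2 := (Complex.continuous_ofReal.tendsto 1).comp h1
    have h3 := (h2.sub_const (ψ (Pf ξ ^ ((1 : ℝ) / m)) : ℂ)).mul_const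
      (((Pf ξ : ℂ) - z) ^ (-(α : ℂ)))
    push_cast at h3 ⊢
    exact h3
end
end

section
/- Assume n > m and let 1 ≤ p ≤ q ≤ ∞ satisfy 0 ≤ 1/p − 1/q < m/n. Then there is a constant C such that for every t > 0 and every Schwartz function f, ‖𝓕⁻¹((1 + tP(·))^{−1} f̂)‖_{L^q} ≤ C t^{−(n/m)(1/p − 1/q)} ‖f‖_{L^p}. -/
open MeasureTheory Complex
open scoped ENNReal RealInnerProductSpace

noncomputable section

theorem young_fin {n : ℕ} (f K : EuclideanSpace ℝ (Fin n) → ℝ≥0∞) (hf : Measurable f)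
    (hK : Measurable K) (α β γ : ℝ) (hβ : 0 < β) (hαβ : β ≤ α) (hα : α ≤ 1)
    (hγ : γ = 1 - α + β) :
    ∫⁻ x, (∫⁻ y, f y * K (x - y)) ^ (1 / β) ≤
      ((∫⁻ x, f x ^ (1 / α)) ^ α * (∫⁻ x, K x ^ (1 / γ)) ^ γ) ^ (1 / β) := by
  have hα0 : 0 < α := hβ.trans_le hαβ
  have hγ0 : 0 < γ := by linarith
  set A := ∫⁻ x, f x ^ (1 / α) with hA
  set B := ∫⁻ x, K x ^ (1 / γ) with hB
  have hpt : ∀ x, (∫⁻ y, f y * K (x - y)) ^ (1 / β) ≤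
      (∫⁻ y, f y ^ (1 / α) * K (x - y) ^ (1 / γ)) * (A ^ ((α - β) / β) * B ^ ((1 - α) / β)) := by
    intro x
    have hKx : Measurable fun y => K (x - y) := hK.comp (measurable_const.sub measurable_id)
    have h1 := ENNReal.lintegral_prod_norm_pow_le (μ := (volume : Measure (EuclideanSpace ℝ (Fin n))))
      (Finset.univ : Finset (Fin 3))
      (f := ![fun y => f y ^ (1 / α) * K (x - y) ^ (1 / γ), fun y => f y ^ (1 / α),
        fun y => K (x - y) ^ (1 / γ)]) (p := ![β, α - β, 1 - α])
      (by
        intro i _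
        fin_cases i
        · exact ((hf.pow_const _).mul (hKx.pow_const _)).aemeasurable
        · exact (hf.pow_const _).aemeasurable
        · exact (hKx.pow_const _).aemeasurable)
      (by simp [Fin.sum_univ_three])
      (by
        intro i _
        fin_cases i
        · exact hβ.le
        · simpa using hαβ
        · simpa using hα)
    simp only [Fin.prod_univ_three, Matrix.cons_val] at h1
    have hBx : ∫⁻ y, K (x - y) ^ (1 / γ) = B :=
      lintegral_sub_left_eq_self (fun y => K y ^ (1 / γ)) x
    rw [hBx] at h1
    have h2 : ∀ y, (f y ^ (1 / α) * K (x - y) ^ (1 / γ)) ^ β * (f y ^ (1 / α)) ^ (α - β) *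
        (K (x - y) ^ (1 / γ)) ^ (1 - α) = f y * K (x - y) := by
      intro y
      rw [ENNReal.mul_rpow_of_nonneg _ _ hβ.le]
      have e1 : (f y ^ (1 / α)) ^ β * (f y ^ (1 / α)) ^ (α - β) = f y := by
        rw [← ENNReal.rpow_add_of_nonneg _ _ hβ.le (by linarith), ← ENNReal.rpow_mul]
        rw [show 1 / α * (β + (α - β)) = 1 by field_simp; ring, ENNReal.rpow_one]
      have e2 : (K (x - y) ^ (1 / γ)) ^ β * (K (x - y) ^ (1 / γ)) ^ (1 - α) = K (x - y) := by
        rw [← ENNReal.rpow_add_of_nonneg _ _ hβ.le (by linarith), ← ENNReal.rpow_mul]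
        rw [show 1 / γ * (β + (1 - α)) = 1 by rw [show β + (1 - α) = γ by linarith]; field_simp,
          ENNReal.rpow_one]
      calc _ = ((f y ^ (1 / α)) ^ β * (f y ^ (1 / α)) ^ (α - β)) *
          ((K (x - y) ^ (1 / γ)) ^ β * (K (x - y) ^ (1 / γ)) ^ (1 - α)) := by ring
        _ = _ := by rw [e1, e2]
    simp_rw [h2] at h1
    calc _ ≤ ((∫⁻ y, f y ^ (1 / α) * K (x - y) ^ (1 / γ)) ^ β * A ^ (α - β) * B ^ (1 - α)) ^ (1 / β) :=
          ENNReal.rpow_le_rpow h1 (by positivity)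
      _ = _ := by
        rw [ENNReal.mul_rpow_of_nonneg _ _ (by positivity),
          ENNReal.mul_rpow_of_nonneg _ _ (by positivity), ← ENNReal.rpow_mul, ← ENNReal.rpow_mul,
          ← ENNReal.rpow_mul, show β * (1 / β) = 1 by field_simp, ENNReal.rpow_one, mul_assoc,
          mul_one_div, mul_one_div]
  have hjm : Measurable (Function.uncurry fun x y => f y ^ (1 / α) * K (x - y) ^ (1 / γ)) := by
    apply Measurable.mul
    · exact (hf.comp measurable_snd).pow_const _
    · exact (hK.comp (measurable_fst.sub measurable_snd)).pow_const _
  calc _ ≤ ∫⁻ x, (∫⁻ y, f y ^ (1 / α) * K (x - y) ^ (1 / γ)) *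
        (A ^ ((α - β) / β) * B ^ ((1 - α) / β)) := lintegral_mono hpt
    _ = (∫⁻ x, (∫⁻ y, f y ^ (1 / α) * K (x - y) ^ (1 / γ))) *
        (A ^ ((α - β) / β) * B ^ ((1 - α) / β)) :=
        lintegral_mul_const _ (Measurable.lintegral_prod_right hjm)
    _ = (A * B) * (A ^ ((α - β) / β) * B ^ ((1 - α) / β)) := by
        congr 1
        rw [lintegral_lintegral_swap hjm.aemeasurable]
        have : ∀ y, ∫⁻ x, f y ^ (1 / α) * K (x - y) ^ (1 / γ) = f y ^ (1 / α) * B := by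
          intro y
          have hm : Measurable fun x => K (x - y) ^ (1 / γ) :=
            (hK.comp (measurable_id.sub_const y)).pow_const _
          rw [lintegral_const_mul _ hm]
          congr 1
          exact lintegral_sub_right_eq_self (fun x => K x ^ (1 / γ)) y
        simp_rw [this]
        rw [lintegral_mul_const _ (hf.pow_const _)]
    _ = (A ^ (1:ℝ) * A ^ ((α - β) / β)) * (B ^ (1:ℝ) * B ^ ((1 - α) / β)) := by
        rw [ENNReal.rpow_one, ENNReal.rpow_one]; ring
    _ = _ := by
        rw [← ENNReal.rpow_add_of_nonneg _ _ zero_le_one (div_nonneg (by linarith) hβ.le),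
          ← ENNReal.rpow_add_of_nonneg _ _ zero_le_one (div_nonneg (by linarith) hβ.le),
          ENNReal.mul_rpow_of_nonneg _ _ (by positivity), ← ENNReal.rpow_mul, ← ENNReal.rpow_mul]
        congr 2
        · field_simp; ring
        · subst hγ; field_simp; ring

theorem holder_conv {n : ℕ} (f K : EuclideanSpace ℝ (Fin n) → ℝ≥0∞) (hf : Measurable f)
    (hK : Measurable K) (α γ : ℝ) (hα0 : 0 < α) (hα : α < 1)
    (hγ : γ = 1 - α) (x) :
    (∫⁻ y, f y * K (x - y)) ≤ (∫⁻ x, f x ^ (1 / α)) ^ α * (∫⁻ x, K x ^ (1 / γ)) ^ γ := by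
  have hγ0 : 0 < γ := by linarith
  have hKx : Measurable fun y => K (x - y) := hK.comp (measurable_const.sub measurable_id)
  have := ENNReal.lintegral_mul_norm_pow_le (μ := (volume : Measure (EuclideanSpace ℝ (Fin n))))
    (hf.pow_const (1 / α)).aemeasurable (hKx.pow_const (1 / γ)).aemeasurable hα0.le hγ0.le
    (by linarith)
  simp_rw [← ENNReal.rpow_mul, one_div_mul_cancel hα0.ne', one_div_mul_cancel hγ0.ne',
    ENNReal.rpow_one] at this
  rwa [lintegral_sub_left_eq_self (fun y => K y ^ (1 / γ)) x] at this

/-- Minkowski via Jensen. -/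
theorem minkowski {E S : Type*} [MeasurableSpace E] [MeasurableSpace S] (μ : Measure E) [SFinite μ]
    (ν : Measure S) [IsFiniteMeasure ν] (F : S → E → ℝ≥0∞) (hF : Measurable (Function.uncurry F))
    (γ : ℝ) (h0 : 0 < γ) (h1 : γ ≤ 1) (M : ℝ≥0∞)
    (hM : ∀ᵐ s ∂ν, ∫⁻ y, F s y ^ (1 / γ) ∂μ ≤ M) :
    (∫⁻ y, (∫⁻ s, F s y ∂ν) ^ (1 / γ) ∂μ) ^ γ ≤ ν Set.univ * M ^ γ := by
  have hpt : ∀ y, (∫⁻ s, F s y ∂ν) ^ (1 / γ) ≤ (∫⁻ s, F s y ^ (1 / γ) ∂ν) *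
      ν Set.univ ^ ((1 - γ) / γ) := by
    intro y
    have hm : Measurable fun s => F s y := hF.comp (measurable_id.prodMk measurable_const)
    have := ENNReal.lintegral_mul_norm_pow_le (μ := ν)
      (hm.pow_const (1 / γ)).aemeasurable (aemeasurable_const (b := (1:ℝ≥0∞))) h0.le
      (by linarith : 0 ≤ 1 - γ) (by linarith)
    simp_rw [← ENNReal.rpow_mul, one_div_mul_cancel h0.ne', ENNReal.one_rpow, mul_one,
      ENNReal.rpow_one] at this
    rw [lintegral_const, one_mul] at this
    have := ENNReal.rpow_le_rpow this (by positivity : 0 ≤ 1 / γ)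
    rwa [ENNReal.mul_rpow_of_nonneg _ _ (by positivity), ← ENNReal.rpow_mul, ← ENNReal.rpow_mul,
      mul_one_div_cancel h0.ne', ENNReal.rpow_one, mul_one_div] at this
  have hFm : Measurable (Function.uncurry fun s y => F s y ^ (1 / γ)) := hF.pow_const _
  calc _ ≤ (∫⁻ y, (∫⁻ s, F s y ^ (1 / γ) ∂ν) * ν Set.univ ^ ((1 - γ) / γ) ∂μ) ^ γ := by
        gcongr with y; exact hpt y
    _ = ((∫⁻ y, (∫⁻ s, F s y ^ (1 / γ) ∂ν) ∂μ) * ν Set.univ ^ ((1 - γ) / γ)) ^ γ := by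
        rw [lintegral_mul_const _ (Measurable.lintegral_prod_left hFm)]
    _ = ((∫⁻ s, (∫⁻ y, F s y ^ (1 / γ) ∂μ) ∂ν) * ν Set.univ ^ ((1 - γ) / γ)) ^ γ := by
        rw [lintegral_lintegral_swap hFm.aemeasurable]
    _ ≤ ((∫⁻ s, M ∂ν) * ν Set.univ ^ ((1 - γ) / γ)) ^ γ := by
        gcongr ?_ ^ γ
        gcongr ?_ * _
        exact lintegral_mono_ae hM
    _ = (M * (ν Set.univ ^ (1:ℝ) * ν Set.univ ^ ((1 - γ) / γ))) ^ γ := by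
        rw [lintegral_const, ENNReal.rpow_one, mul_assoc]
    _ = _ := by
        rw [← ENNReal.rpow_add_of_nonneg _ _ zero_le_one (div_nonneg (by linarith) h0.le),
          show 1 + (1 - γ) / γ = 1 / γ by field_simp; ring,
          ENNReal.mul_rpow_of_nonneg _ _ h0.le, ← ENNReal.rpow_mul, one_div_mul_cancel h0.ne',
          ENNReal.rpow_one, mul_comm]

theorem eval_hom {n m : ℕ} (P : MvPolynomial (Fin n) ℝ) (hhom : P.IsHomogeneous m) (c : ℝ)
    (x : Fin n → ℝ) :
    MvPolynomial.eval (fun i => c * x i) P = c ^ m * MvPolynomial.eval x P := by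
  rw [MvPolynomial.eval_eq, MvPolynomial.eval_eq, Finset.mul_sum]
  refine Finset.sum_congr rfl fun d hd => ?_
  have h := hhom (MvPolynomial.mem_support_iff.mp hd)
  have h2 : ∑ i ∈ d.support, d i = m := by
    rw [← h, Finsupp.weight_apply, Finsupp.sum]; simp
  simp_rw [mul_pow]
  rw [Finset.prod_mul_distrib, Finset.prod_pow_eq_pow_sum, h2]
  ring

theorem temp_poly {n : ℕ} (P : MvPolynomial (Fin n) ℝ) :
    Function.HasTemperateGrowth
      (fun ξ : EuclideanSpace ℝ (Fin n) => MvPolynomial.eval (fun i => ξ i) P) := by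
  induction P using MvPolynomial.induction_on with
  | C a => simp
  | add p q hp hq => simp only [map_add]; exact hp.add hq
  | mul_X p i hp =>
    simp only [map_mul, MvPolynomial.eval_X]
    exact hp.mul (EuclideanSpace.proj (𝕜 := ℝ) i).hasTemperateGrowth

theorem poly_lower {n m : ℕ} (hm : 2 ≤ m) (Pf : EuclideanSpace ℝ (Fin n) → ℝ)
    (hc : Continuous Pf) (hs : ∀ (c : ℝ) ξ, Pf (c • ξ) = c ^ m * Pf ξ)
    (hell : ∀ ξ : EuclideanSpace ℝ (Fin n), ξ ≠ 0 → 0 < Pf ξ) :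
    (∀ ξ, 0 ≤ Pf ξ) ∧ ∃ c : ℝ, 0 < c ∧ ∀ ξ, c * (‖ξ‖ - 1) ≤ Pf ξ := by
  have h0 : ∀ ξ, 0 ≤ Pf ξ := by
    intro ξ
    by_cases h : ξ = 0
    · have := hs 0 0
      rw [zero_smul, zero_pow (by omega), zero_mul] at this
      rw [h, this]
    · exact (hell ξ h).le
  refine ⟨h0, ?_⟩
  obtain ⟨c, hc0, hcb⟩ : ∃ c : ℝ, 0 < c ∧ ∀ ξ ∈ Metric.sphere (0 : EuclideanSpace ℝ (Fin n)) 1,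
      c ≤ Pf ξ := by
    rcases (Metric.sphere (0 : EuclideanSpace ℝ (Fin n)) 1).eq_empty_or_nonempty with h | h
    · exact ⟨1, one_pos, by simp [h]⟩
    · obtain ⟨x, hx, hmin⟩ := (isCompact_sphere _ _).exists_isMinOn h hc.continuousOn
      refine ⟨Pf x, hell x ?_, fun ξ hξ => hmin hξ⟩
      rintro rfl
      simp at hx
  refine ⟨c, hc0, fun ξ => ?_⟩
  by_cases h : ‖ξ‖ ≤ 1
  · exact le_trans (mul_nonpos_of_nonneg_of_nonpos hc0.le (by linarith)) (h0 ξ)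
  · push Not at h
    have hpos : 0 < ‖ξ‖ := by linarith
    have h1 := hs ‖ξ‖ (‖ξ‖⁻¹ • ξ)
    rw [smul_inv_smul₀ hpos.ne'] at h1
    have h2 : c ≤ Pf (‖ξ‖⁻¹ • ξ) := by
      apply hcb
      simp [norm_smul, hpos.ne']
    have h3 : ‖ξ‖ ≤ ‖ξ‖ ^ m := le_self_pow₀ h.le (by omega)
    rw [h1]
    nlinarith

theorem exp_schwartz {n : ℕ} (Pf : EuclideanSpace ℝ (Fin n) → ℝ)
    (ht : Pf.HasTemperateGrowth) (c : ℝ) (hc : 0 < c) (hb : ∀ ξ, c * (‖ξ‖ - 1) ≤ Pf ξ) :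
    ∃ g : SchwartzMap (EuclideanSpace ℝ (Fin n)) ℂ, ∀ ξ, g ξ = ((Real.exp (-Pf ξ) : ℝ) : ℂ) := by
  have hdec : ∀ k l : ℕ, ∃ C : ℝ, ∀ x, ‖x‖ ^ k *
      ‖iteratedFDeriv ℝ l ((fun s : ℝ => Real.exp ((-1) * s)) ∘ Pf) x‖ ≤ C := by
    intro k l
    obtain ⟨K, C, hC, hD⟩ := ht.norm_iteratedFDeriv_le_uniform l
    refine ⟨l.factorial * (1 + C) ^ l * Real.exp (2 * c) * ((k + K * l).factorial / c ^ (k + K * l)),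
      fun x => ?_⟩
    have h1 := norm_iteratedFDeriv_comp_le (𝕜 := ℝ) (g := fun s : ℝ => Real.exp ((-1) * s)) (f := Pf)
      (n := l) (N := (⊤ : ℕ∞)) (by fun_prop) ht.1 (mod_cast le_top) x (C := Real.exp (-Pf x))
      (D := (1 + C) * (1 + ‖x‖) ^ K)
      (by
        intro i _
        rw [norm_iteratedFDeriv_eq_norm_iteratedDeriv, iteratedDeriv_exp_const_mul]
        simp)
      (by
        intro i hi hil
        have hge : 1 ≤ (1 + C) * (1 + ‖x‖) ^ K :=
          one_le_mul_of_one_le_of_one_le (by linarith) (one_le_pow₀ (by simp))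
        calc _ ≤ C * (1 + ‖x‖) ^ K := hD i hil x
          _ ≤ (1 + C) * (1 + ‖x‖) ^ K := by gcongr; linarith
          _ ≤ _ := le_self_pow₀ hge (by omega))
    have h2 : Real.exp (-Pf x) ≤ Real.exp (2 * c) * Real.exp (-(c * (1 + ‖x‖))) := by
      rw [← Real.exp_add]
      apply Real.exp_le_exp.mpr
      linarith [hb x]
    have h3 : (1 + ‖x‖) ^ (k + K * l) * Real.exp (-(c * (1 + ‖x‖))) ≤
        (k + K * l).factorial / c ^ (k + K * l) := by
      have := Real.pow_div_factorial_le_exp (c * (1 + ‖x‖)) (by positivity) (k + K * l)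
      rw [Real.exp_neg, ← div_eq_mul_inv, div_le_div_iff₀ (by positivity) (by positivity)]
      rw [div_le_iff₀ (by positivity), mul_pow] at this
      linarith
    calc _ ≤ (1 + ‖x‖) ^ k * (l.factorial * (Real.exp (2 * c) * Real.exp (-(c * (1 + ‖x‖))))
          * ((1 + C) * (1 + ‖x‖) ^ K) ^ l) := by
          gcongr
          · linarith
          · refine h1.trans ?_
            gcongr
      _ = l.factorial * (1 + C) ^ l * Real.exp (2 * c) *
          ((1 + ‖x‖) ^ (k + K * l) * Real.exp (-(c * (1 + ‖x‖)))) := by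
          rw [mul_pow, ← pow_mul, pow_add]; ring
      _ ≤ _ := by gcongr
  let g0 : SchwartzMap (EuclideanSpace ℝ (Fin n)) ℝ :=
    ⟨(fun s : ℝ => Real.exp ((-1) * s)) ∘ Pf, by have := ht.1; fun_prop, hdec⟩
  refine ⟨SchwartzMap.postcompCLM (𝕜 := ℝ) Complex.ofRealCLM g0, fun ξ => ?_⟩
  have : g0 ξ = Real.exp (-1 * Pf ξ) := rfl
  simp [this]
open scoped FourierTransform

theorem lintegral_smul_E {n : ℕ} (h : EuclideanSpace ℝ (Fin n) → ℝ≥0∞) (hh : Measurable h)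
    (b : ℝ) (hb : 0 < b) :
    ∫⁻ z, h (b • z) = ENNReal.ofReal ((b ^ n)⁻¹) * ∫⁻ z, h z := by
  rw [← lintegral_map (f := h) (g := fun z => b • z) hh (by fun_prop),
    Measure.map_addHaar_smul _ hb.ne', lintegral_smul_measure, finrank_euclideanSpace_fin,
    abs_of_pos (by positivity), smul_eq_mul]

/-- the scale -/
def bsc (m : ℕ) (τ : ℝ) : ℝ := τ ^ (-(1 / (m : ℝ))) / (2 * Real.pi)

theorem bsc_pos (m : ℕ) {τ : ℝ} (h : 0 < τ) : 0 < bsc m τ := by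
  unfold bsc; positivity

theorem ift_exp {n m : ℕ} (hm : 2 ≤ m) (Pf : EuclideanSpace ℝ (Fin n) → ℝ)
    (hs : ∀ (c : ℝ) ξ, Pf (c • ξ) = c ^ m * Pf ξ)
    (g : SchwartzMap (EuclideanSpace ℝ (Fin n)) ℂ)
    (hg : ∀ ξ, g ξ = ((Real.exp (-Pf ξ) : ℝ) : ℂ)) (τ : ℝ) (hτ : 0 < τ)
    (y : EuclideanSpace ℝ (Fin n)) :
    IFT (fun ξ => ((Real.exp (-(τ * Pf ξ)) : ℝ) : ℂ)) y =
      ((bsc m τ ^ n : ℝ) : ℂ) * (𝓕⁻ g) (bsc m τ • y) := by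
  set R : ℝ := τ ^ (1 / (m : ℝ)) with hR
  have hRpos : 0 < R := by positivity
  have hRm : R ^ m = τ := by
    rw [hR, ← Real.rpow_natCast, ← Real.rpow_mul hτ.le, one_div_mul_cancel (by positivity),
      Real.rpow_one]
  have hbR : bsc m τ = R⁻¹ / (2 * Real.pi) := by
    rw [bsc, Real.rpow_neg hτ.le]
  have h1 := Measure.integral_comp_smul (volume : Measure (EuclideanSpace ℝ (Fin n)))
    (fun v => Complex.exp ((↑(2 * Real.pi * ⟪v, bsc m τ • y⟫) * Complex.I)) • g v) R
  rw [SchwartzMap.fourierInv_coe, Real.fourierInv_eq', IFT]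
  have h2 : ∀ ξ : EuclideanSpace ℝ (Fin n),
      Complex.exp (Complex.I * (⟪y, ξ⟫ : ℂ)) * ((Real.exp (-(τ * Pf ξ)) : ℝ) : ℂ) =
      Complex.exp ((↑(2 * Real.pi * ⟪R • ξ, bsc m τ • y⟫) * Complex.I)) • g (R • ξ) := by
    intro ξ
    rw [hg, hs, hRm, smul_eq_mul, inner_smul_left, inner_smul_right, hbR, real_inner_comm,
      mul_comm Complex.I]
    congr 4
    simp
    field_simp
  simp_rw [h2]
  rw [h1, finrank_euclideanSpace_fin, abs_of_pos (by positivity), hbR, Complex.real_smul,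
    ← mul_assoc]
  congr 1
  push_cast
  rw [div_pow, inv_pow, mul_comm, div_eq_mul_inv]

theorem ft_eq {n : ℕ} (f : EuclideanSpace ℝ (Fin n) → ℂ) (ξ : EuclideanSpace ℝ (Fin n)) :
    FT f ξ = 𝓕 f ((2 * Real.pi)⁻¹ • ξ) := by
  rw [Real.fourier_eq', FT]
  congr 1
  ext x
  rw [smul_eq_mul, inner_smul_right]
  congr 2
  push_cast
  field_simp

theorem ft_integrable {n : ℕ} (f : SchwartzMap (EuclideanSpace ℝ (Fin n)) ℂ) :
    Integrable (FT (⇑f)) := by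
  have : FT (⇑f) = fun ξ => (𝓕 f) ((2 * Real.pi)⁻¹ • ξ) := by
    ext ξ; rw [ft_eq, SchwartzMap.fourier_coe]
  rw [this]
  exact (SchwartzMap.integrable (𝓕 f)).comp_smul (by positivity)

theorem ift_conv {n : ℕ} (h f : EuclideanSpace ℝ (Fin n) → ℂ) (hh : Integrable h)
    (hf : Integrable f) (x : EuclideanSpace ℝ (Fin n)) :
    IFT (fun ξ => h ξ * FT f ξ) x = ∫ y, f y * IFT h (x - y) := by
  unfold IFT FT
  have hint : Integrable (Function.uncurry fun ξ y : EuclideanSpace ℝ (Fin n) =>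
      Complex.exp (Complex.I * (⟪x - y, ξ⟫ : ℂ)) * (h ξ * f y)) (volume.prod volume) := by
    refine (hh.mul_prod hf).bdd_mul (c := 1) ?_ ?_
    · apply Continuous.aestronglyMeasurable
      fun_prop
    · refine Filter.Eventually.of_forall fun z => ?_
      rw [mul_comm, Complex.norm_exp_ofReal_mul_I]
  have h1 : ∀ ξ, Complex.exp (Complex.I * (⟪x, ξ⟫ : ℂ)) * (h ξ *
      ∫ y, Complex.exp (-Complex.I * (⟪y, ξ⟫ : ℂ)) * f y) =
      ∫ y, Complex.exp (Complex.I * (⟪x - y, ξ⟫ : ℂ)) * (h ξ * f y) := by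
    intro ξ
    rw [← mul_assoc, ← integral_const_mul]
    congr 1
    ext y
    rw [inner_sub_left, Complex.ofReal_sub, mul_sub, sub_eq_add_neg, Complex.exp_add, neg_mul]
    ring
  simp_rw [h1]
  rw [integral_integral_swap hint, ← integral_const_mul]
  congr 1
  ext y
  rw [mul_left_comm, ← integral_const_mul (f y)]
  congr 2
  ext ξ
  ring

theorem resolvent_rep {n : ℕ} (Pf : EuclideanSpace ℝ (Fin n) → ℝ) (hc : Continuous Pf)
    (h0 : ∀ ξ, 0 ≤ Pf ξ) (u : EuclideanSpace ℝ (Fin n) → ℂ) (hu : Integrable u) (t : ℝ)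
    (ht : 0 < t) (x : EuclideanSpace ℝ (Fin n)) :
    IFT (fun ξ => ((1 + t * Pf ξ : ℝ) : ℂ)⁻¹ * u ξ) x =
      ∫ s in Set.Ioi (0:ℝ), ((Real.exp (-s) : ℝ) : ℂ) *
        IFT (fun ξ => ((Real.exp (-(t * s * Pf ξ)) : ℝ) : ℂ) * u ξ) x := by
  unfold IFT
  have hexp : Integrable (fun s : ℝ => ((Real.exp (-s) : ℝ) : ℂ)) (volume.restrict (Set.Ioi 0)) := by
    have := (integrableOn_exp_neg_Ioi 0)
    exact this.ofReal
  have hint : Integrable (Function.uncurry fun (ξ : EuclideanSpace ℝ (Fin n)) (s : ℝ) =>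
      (Complex.exp (Complex.I * (⟪x, ξ⟫ : ℂ)) * ((Real.exp (-(t * s * Pf ξ)) : ℝ) : ℂ)) *
        (u ξ * ((Real.exp (-s) : ℝ) : ℂ))) (volume.prod (volume.restrict (Set.Ioi 0))) := by
    refine (hu.mul_prod hexp).bdd_mul (c := 1) ?_ ?_
    · apply Continuous.aestronglyMeasurable
      fun_prop
    · have : ∀ᵐ z ∂((volume : Measure (EuclideanSpace ℝ (Fin n))).prod
          (volume.restrict (Set.Ioi (0:ℝ)))), 0 < z.2 :=
        (Measure.quasiMeasurePreserving_snd).ae (ae_restrict_mem measurableSet_Ioi)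
      filter_upwards [this] with z hz
      rw [norm_mul, mul_comm Complex.I, Complex.norm_exp_ofReal_mul_I, one_mul,
        Complex.norm_real, Real.norm_of_nonneg (Real.exp_pos _).le, Real.exp_le_one_iff]
      have := h0 z.1
      have : 0 ≤ t * z.2 * Pf z.1 := by positivity
      linarith
  have h1 : ∀ ξ, Complex.exp (Complex.I * (⟪x, ξ⟫ : ℂ)) *
      (((1 + t * Pf ξ : ℝ) : ℂ)⁻¹ * u ξ) = ∫ s in Set.Ioi (0:ℝ),
      (Complex.exp (Complex.I * (⟪x, ξ⟫ : ℂ)) * ((Real.exp (-(t * s * Pf ξ)) : ℝ) : ℂ)) *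
        (u ξ * ((Real.exp (-s) : ℝ) : ℂ)) := by
    intro ξ
    have hp : 0 < 1 + t * Pf ξ := by have := h0 ξ; positivity
    have e1 : ∫ s in Set.Ioi (0:ℝ), Real.exp (-(1 + t * Pf ξ) * s) = (1 + t * Pf ξ)⁻¹ := by
      rw [integral_exp_mul_Ioi (by linarith)]
      rw [mul_zero, Real.exp_zero, div_neg, neg_div, neg_neg, one_div]
    rw [← Complex.ofReal_inv, ← e1, ← integral_complex_ofReal, mul_left_comm, mul_comm,
      ← integral_const_mul]
    congr 1
    ext s
    have : -(1 + t * Pf ξ) * s = -(t * s * Pf ξ) + -s := by ring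
    rw [this, Real.exp_add]
    push_cast
    ring
  simp_rw [h1]
  rw [integral_integral_swap hint, ← integral_const_mul]
  congr 1
  ext s
  rw [mul_left_comm, ← integral_const_mul (((Real.exp (-s) : ℝ) : ℂ))]
  congr 2
  ext ξ
  ring

/-- dominating kernel -/
def Kdom {n : ℕ} (m : ℕ) (H : EuclideanSpace ℝ (Fin n) → ℂ) (t : ℝ)
    (z : EuclideanSpace ℝ (Fin n)) : ℝ≥0∞ :=
  ∫⁻ s in Set.Ioi (0:ℝ), ENNReal.ofReal (Real.exp (-s)) *
    ‖((bsc m (t * s) ^ n : ℝ) : ℂ) * H (bsc m (t * s) • z)‖ₑ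

theorem bsc_meas (m : ℕ) : Measurable (bsc m) := by
  unfold bsc; fun_prop

theorem Kjoint {n : ℕ} (m : ℕ) (H : EuclideanSpace ℝ (Fin n) → ℂ) (hH : Continuous H) (t : ℝ) :
    Measurable (Function.uncurry fun (s : ℝ) (z : EuclideanSpace ℝ (Fin n)) =>
      ‖((bsc m (t * s) ^ n : ℝ) : ℂ) * H (bsc m (t * s) • z)‖ₑ) := by
  have hb := bsc_meas m
  have h1 : Measurable fun w : ℝ × EuclideanSpace ℝ (Fin n) => bsc m (t * w.1) :=
    hb.comp (measurable_fst.const_mul t)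
  apply Measurable.enorm
  apply Measurable.mul
  · exact Complex.measurable_ofReal.comp (h1.pow_const n)
  · exact hH.measurable.comp (h1.smul measurable_snd)

theorem Kjoint' {n : ℕ} (m : ℕ) (H : EuclideanSpace ℝ (Fin n) → ℂ) (hH : Continuous H) (t : ℝ)
    {Ω : Type} [MeasurableSpace Ω] (u : Ω → ℝ) (v : Ω → EuclideanSpace ℝ (Fin n))
    (hu : Measurable u) (hv : Measurable v) :
    Measurable fun w => ‖((bsc m (t * u w) ^ n : ℝ) : ℂ) * H (bsc m (t * u w) • v w)‖ₑ := by
  have h1 : Measurable fun w => bsc m (t * u w) := (bsc_meas m).comp (hu.const_mul t)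
  apply Measurable.enorm
  exact (Complex.measurable_ofReal.comp (h1.pow_const n)).mul
    (hH.measurable.comp (h1.smul hv))

theorem Kdom_meas {n : ℕ} (m : ℕ) (H : EuclideanSpace ℝ (Fin n) → ℂ) (hH : Continuous H) (t : ℝ) :
    Measurable (Kdom m H t) := by
  unfold Kdom
  refine Measurable.lintegral_prod_left (f := fun (s : ℝ) (z : EuclideanSpace ℝ (Fin n)) =>
    ENNReal.ofReal (Real.exp (-s)) *
    ‖((bsc m (t * s) ^ n : ℝ) : ℂ) * H (bsc m (t * s) • z)‖ₑ) ?_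
  exact Measurable.mul (f := fun w : ℝ × EuclideanSpace ℝ (Fin n) =>
    ENNReal.ofReal (Real.exp (-w.1))) (by fun_prop) (Kjoint m H hH t)

theorem pointwise_bound {n m : ℕ} (hm : 2 ≤ m) (Pf : EuclideanSpace ℝ (Fin n) → ℝ)
    (hc : Continuous Pf) (h0 : ∀ ξ, 0 ≤ Pf ξ)
    (hs : ∀ (c : ℝ) ξ, Pf (c • ξ) = c ^ m * Pf ξ)
    (g : SchwartzMap (EuclideanSpace ℝ (Fin n)) ℂ)
    (hg : ∀ ξ, g ξ = ((Real.exp (-Pf ξ) : ℝ) : ℂ)) (t : ℝ) (ht : 0 < t)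
    (f : SchwartzMap (EuclideanSpace ℝ (Fin n)) ℂ) (x : EuclideanSpace ℝ (Fin n)) :
    ‖IFT (fun ξ => ((1 + t * Pf ξ : ℝ) : ℂ)⁻¹ * FT (⇑f) ξ) x‖ₑ ≤
      ∫⁻ y, ‖f y‖ₑ * Kdom m (⇑(𝓕⁻ g : SchwartzMap (EuclideanSpace ℝ (Fin n)) ℂ)) t (x - y) := by
  have hH : Continuous (𝓕⁻ g : SchwartzMap (EuclideanSpace ℝ (Fin n)) ℂ) := (𝓕⁻ g).continuous
  have hgi : ∀ τ : ℝ, 0 < τ →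
      Integrable (fun ξ => ((Real.exp (-(τ * Pf ξ)) : ℝ) : ℂ)) := by
    intro τ hτ
    set R : ℝ := τ ^ (1 / (m : ℝ)) with hR
    have hRpos : 0 < R := by positivity
    have hRm : R ^ m = τ := by
      rw [hR, ← Real.rpow_natCast, ← Real.rpow_mul hτ.le, one_div_mul_cancel (by positivity),
        Real.rpow_one]
    have := (SchwartzMap.integrable g (μ := volume)).comp_smul hRpos.ne'
    refine this.congr (Filter.Eventually.of_forall fun ξ => ?_)
    simp only [hg, hs, hRm]
  rw [resolvent_rep Pf hc h0 _ (ft_integrable f) t ht x]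
  have hjm : Measurable (Function.uncurry fun (s : ℝ) (y : EuclideanSpace ℝ (Fin n)) =>
      ‖f y‖ₑ * (ENNReal.ofReal (Real.exp (-s)) *
          ‖((bsc m (t * s) ^ n : ℝ) : ℂ) * (𝓕⁻ g) (bsc m (t * s) • (x - y))‖ₑ)) := by
    have m1 : Measurable fun w : ℝ × EuclideanSpace ℝ (Fin n) => ‖f w.2‖ₑ :=
      (f.continuous.comp continuous_snd).measurable.enorm
    have m2 : Measurable fun w : ℝ × EuclideanSpace ℝ (Fin n) =>
        ENNReal.ofReal (Real.exp (-w.1)) := by fun_prop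
    have m3 := Kjoint' m (⇑(𝓕⁻ g : SchwartzMap (EuclideanSpace ℝ (Fin n)) ℂ)) hH t (fun w : ℝ × EuclideanSpace ℝ (Fin n) => w.1)
      (fun w => x - w.2) measurable_fst (measurable_snd.const_sub x)
    exact m1.mul (m2.mul m3)
  calc _ ≤ ∫⁻ s in Set.Ioi (0:ℝ), ‖((Real.exp (-s) : ℝ) : ℂ) *
        IFT (fun ξ => ((Real.exp (-(t * s * Pf ξ)) : ℝ) : ℂ) * FT (⇑f) ξ) x‖ₑ :=
        enorm_integral_le_lintegral_enorm _
    _ ≤ ∫⁻ s in Set.Ioi (0:ℝ), ∫⁻ y, ‖f y‖ₑ * (ENNReal.ofReal (Real.exp (-s)) *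
          ‖((bsc m (t * s) ^ n : ℝ) : ℂ) * (𝓕⁻ g) (bsc m (t * s) • (x - y))‖ₑ) := by
        refine setLIntegral_mono' measurableSet_Ioi fun s hs' => ?_
        have hts : 0 < t * s := mul_pos ht hs'
        rw [ift_conv _ _ (hgi (t * s) hts) (SchwartzMap.integrable f), enorm_mul]
        simp_rw [ift_exp hm Pf hs g hg (t * s) hts]
        calc _ ≤ ‖((Real.exp (-s) : ℝ) : ℂ)‖ₑ * ∫⁻ y, ‖f y *
              (((bsc m (t * s) ^ n : ℝ) : ℂ) * (𝓕⁻ g) (bsc m (t * s) • (x - y)))‖ₑ := by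
              gcongr; exact enorm_integral_le_lintegral_enorm _
          _ = _ := by
              rw [← lintegral_const_mul' _ _ enorm_ne_top]
              congr 1
              ext y
              have : ‖((Real.exp (-s) : ℝ) : ℂ)‖ₑ = ENNReal.ofReal (Real.exp (-s)) := by
                rw [← ofReal_norm, Complex.norm_real,
                  Real.norm_of_nonneg (Real.exp_pos _).le]
              rw [this, enorm_mul (f y)]
              ring
    _ = ∫⁻ y, ∫⁻ s in Set.Ioi (0:ℝ), ‖f y‖ₑ * (ENNReal.ofReal (Real.exp (-s)) *
          ‖((bsc m (t * s) ^ n : ℝ) : ℂ) * (𝓕⁻ g) (bsc m (t * s) • (x - y))‖ₑ) := by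
        rw [lintegral_lintegral_swap]
        apply Measurable.aemeasurable
        exact hjm
    _ = _ := by
        congr 1
        ext y
        rw [lintegral_const_mul' _ _ enorm_ne_top, Kdom]

theorem Kdom_norm {n m : ℕ} (hm : 2 ≤ m)
    (H : SchwartzMap (EuclideanSpace ℝ (Fin n)) ℂ) (γ : ℝ) (hγ0 : 0 < γ) (hγ1 : γ ≤ 1)
    (ha : (n : ℝ) / m * (1 - γ) < 1) :
    ∃ C : ℝ, 0 < C ∧ ∀ t : ℝ, 0 < t →
      (∫⁻ z, Kdom m H t z ^ (1 / γ)) ^ γ ≤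
        ENNReal.ofReal (C * t ^ (-((n : ℝ) / m * (1 - γ)))) := by
  set a : ℝ := (n : ℝ) / m * (1 - γ) with hadef
  have hρ : Measurable fun s : ℝ => ENNReal.ofReal (Real.exp (-s) * s ^ (-a)) := by fun_prop
  set ν : Measure ℝ := (volume.restrict (Set.Ioi (0:ℝ))).withDensity
    (fun s => ENNReal.ofReal (Real.exp (-s) * s ^ (-a))) with hν
  have hfin : IsFiniteMeasure ν := by
    have := Real.GammaIntegral_convergent (s := 1 - a) (by linarith)
    simp only [show (1 - a - 1) = -a by ring] at this
    exact isFiniteMeasure_withDensity_ofReal this.2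
  set M0 : ℝ≥0∞ := ∫⁻ z, ‖H z‖ₑ ^ (1 / γ) with hM0
  have hM0fin : M0 ≠ ⊤ := by
    have h1 := (H.memLp (ENNReal.ofReal (1 / γ)) volume).eLpNorm_lt_top
    have h2 := lintegral_rpow_enorm_lt_top_of_eLpNorm_lt_top (p := ENNReal.ofReal (1 / γ))
      (by simpa using hγ0) ENNReal.ofReal_ne_top h1
    rw [ENNReal.toReal_ofReal (by positivity)] at h2
    exact h2.ne
  set c0 : ℝ := (2 * Real.pi) ^ (-((n : ℝ) * (1 - γ))) with hc0
  have hc0pos : 0 < c0 := by positivity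
  refine ⟨(ν Set.univ).toReal * c0 * (M0 ^ γ).toReal + 1, by positivity, fun t ht => ?_⟩
  have hj := Kjoint m _ H.continuous t
  have hK : ∀ z, Kdom m H t z = ∫⁻ s, ENNReal.ofReal (s ^ a) *
      ‖((bsc m (t * s) ^ n : ℝ) : ℂ) * H (bsc m (t * s) • z)‖ₑ ∂ν := by
    intro z
    rw [hν, lintegral_withDensity_eq_lintegral_mul _ hρ, Kdom]
    · refine setLIntegral_congr_fun measurableSet_Ioi fun s hs => ?_
      have hs : 0 < s := hs
      simp only [Pi.mul_apply]
      rw [← mul_assoc, ← ENNReal.ofReal_mul (by positivity), mul_assoc (Real.exp (-s)),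
        ← Real.rpow_add hs]
      simp
    · exact Measurable.mul (f := fun s : ℝ => ENNReal.ofReal (s ^ a)) (by fun_prop)
        (Kjoint' m _ H.continuous t (fun s => s) (fun _ => z) measurable_id measurable_const)
  have hmk := minkowski (volume : Measure (EuclideanSpace ℝ (Fin n))) ν
    (fun s z => ENNReal.ofReal (s ^ a) *
      ‖((bsc m (t * s) ^ n : ℝ) : ℂ) * H (bsc m (t * s) • z)‖ₑ)
    (Measurable.mul (f := fun w : ℝ × EuclideanSpace ℝ (Fin n) =>
      ENNReal.ofReal (w.1 ^ a)) (by fun_prop) hj) γ hγ0 hγ1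
    (ENNReal.ofReal ((c0 * t ^ (-a)) ^ (1 / γ)) * M0)
    (by
      have hae : ∀ᵐ s ∂ν, s ∈ Set.Ioi (0:ℝ) :=
        (withDensity_absolutelyContinuous _ _).ae_le (ae_restrict_mem measurableSet_Ioi)
      filter_upwards [hae] with s hs
      have hs : 0 < s := hs
      have hts : 0 < t * s := mul_pos ht hs
      have hb := bsc_pos m hts
      set b := bsc m (t * s) with hbdef
      have e1 : ∀ z, (ENNReal.ofReal (s ^ a) * ‖((b ^ n : ℝ) : ℂ) * H (b • z)‖ₑ) ^ (1 / γ) =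
          ENNReal.ofReal ((s ^ a * b ^ n) ^ (1 / γ)) * ‖H (b • z)‖ₑ ^ (1 / γ) := by
        intro z
        have : ‖((b ^ n : ℝ) : ℂ)‖ₑ = ENNReal.ofReal (b ^ n) := by
          rw [← ofReal_norm, Complex.norm_real, Real.norm_of_nonneg (by positivity)]
        rw [enorm_mul, this, ← mul_assoc, ← ENNReal.ofReal_mul (by positivity),
          ENNReal.mul_rpow_of_nonneg _ _ (by positivity),
          ENNReal.ofReal_rpow_of_nonneg (by positivity) (by positivity)]
      simp_rw [e1]
      rw [lintegral_const_mul' _ _ ENNReal.ofReal_ne_top,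
        lintegral_smul_E (fun z => ‖H z‖ₑ ^ (1 / γ))
          (H.continuous.measurable.enorm.pow_const _) b hb, ← mul_assoc,
        ← ENNReal.ofReal_mul (by positivity)]
      apply le_of_eq
      congr 2
      have e2 : (b ^ n)⁻¹ = ((b ^ n : ℝ) ^ (-γ)) ^ (1 / γ) := by
        rw [← Real.rpow_mul (by positivity), show -γ * (1 / γ) = -1 by field_simp,
          Real.rpow_neg_one]
      rw [e2, ← Real.mul_rpow (by positivity) (by positivity)]
      congr 1
      have e3 : (b ^ n : ℝ) * (b ^ n : ℝ) ^ (-γ) = b ^ ((n : ℝ) * (1 - γ)) := by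
        nth_rewrite 1 [← Real.rpow_one (b ^ n)]
        rw [← Real.rpow_add (by positivity), ← Real.rpow_natCast, ← Real.rpow_mul hb.le, sub_eq_add_neg]
      rw [mul_assoc, e3, hbdef, bsc, Real.div_rpow (by positivity) (by positivity),
        ← Real.rpow_mul hts.le, Real.mul_rpow ht.le hs.le, hc0, Real.rpow_neg (by positivity)]
      have e4 : -(1 / (m : ℝ)) * ((n : ℝ) * (1 - γ)) = -a := by rw [hadef]; ring
      rw [e4, Real.rpow_neg hs.le]
      field_simp)
  simp_rw [hK]
  refine hmk.trans ?_
  rw [ENNReal.mul_rpow_of_nonneg _ _ hγ0.le, ENNReal.ofReal_rpow_of_nonneg (by positivity) hγ0.le,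
    ← Real.rpow_mul (by positivity), one_div_mul_cancel hγ0.ne', Real.rpow_one]
  have hM0γ : M0 ^ γ ≠ ⊤ := ENNReal.rpow_ne_top_of_nonneg hγ0.le hM0fin
  rw [← ENNReal.ofReal_toReal (measure_ne_top ν Set.univ), ← ENNReal.ofReal_toReal hM0γ,
    ← ENNReal.ofReal_mul (by positivity), ← ENNReal.ofReal_mul (by positivity)]
  apply ENNReal.ofReal_le_ofReal
  have : 0 < t ^ (-a) := by positivity
  rw [ENNReal.toReal_ofReal (by positivity), ENNReal.toReal_ofReal (by positivity)]
  nlinarith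

/-- `L^p → L^q` bounds for the resolvent `(I + tP(D))^{−1}` when `0 ≤ 1/p − 1/q < m/n`. -/
theorem statement13
    (n m : ℕ) (hn : 2 ≤ n) (hm : 2 ≤ m) (hnm : m < n)
    (P : MvPolynomial (Fin n) ℝ) (hhom : P.IsHomogeneous m)
    (Pf : EuclideanSpace ℝ (Fin n) → ℝ)
    (hPf : ∀ ξ, Pf ξ = MvPolynomial.eval (fun i => ξ i) P)
    (hell : ∀ ξ : EuclideanSpace ℝ (Fin n), ξ ≠ 0 → 0 < Pf ξ)
    (hnd : ∀ ξ : EuclideanSpace ℝ (Fin n), ξ ≠ 0 → HessDet Pf ξ ≠ 0)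
    (p q : ℝ≥0∞) (hp : 1 ≤ p) (hpq : p ≤ q)
    (hup : (1/p).toReal - (1/q).toReal < (m : ℝ) / (n : ℝ)) :
    ∃ C : ℝ, 0 < C ∧ ∀ t : ℝ, 0 < t →
      ∀ f : SchwartzMap (EuclideanSpace ℝ (Fin n)) ℂ,
        eLpNorm (IFT (fun ξ => ((1 + t * Pf ξ : ℝ) : ℂ)⁻¹ * FT (⇑f) ξ)) q volume ≤
          ENNReal.ofReal (C * t ^
            (-((n : ℝ)/(m : ℝ)) * ((1/p).toReal - (1/q).toReal))) *
          eLpNorm (⇑f) p volume := by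
  have hPf' : Pf = fun ξ : EuclideanSpace ℝ (Fin n) => MvPolynomial.eval (fun i => ξ i) P :=
    funext hPf
  have htemp : Pf.HasTemperateGrowth := by rw [hPf']; exact temp_poly P
  have hcont : Continuous Pf := htemp.1.continuous
  have hs : ∀ (c : ℝ) ξ, Pf (c • ξ) = c ^ m * Pf ξ := by
    intro c ξ
    rw [hPf, hPf, ← eval_hom P hhom]
    rfl
  obtain ⟨h0, c, hc, hb⟩ := poly_lower hm Pf hcont hs hell
  obtain ⟨g, hg⟩ := exp_schwartz Pf htemp c hc hb
  have hnpos : (0:ℝ) < n := by positivity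
  have hmpos : (0:ℝ) < m := by positivity
  have hmn : (m : ℝ) / n < 1 := by rw [div_lt_one hnpos]; exact_mod_cast hnm
  set α : ℝ := (1 / p).toReal with hα
  set β : ℝ := (1 / q).toReal with hβ
  have hinvp : 1 / p ≤ 1 := by rw [one_div]; exact ENNReal.inv_le_one.mpr hp
  have hα1 : α ≤ 1 := by
    rw [hα]; exact ENNReal.toReal_le_of_le_ofReal zero_le_one (by simpa using hp)
  have hβ0 : 0 ≤ β := ENNReal.toReal_nonneg
  have hβα : β ≤ α := ENNReal.toReal_mono (ne_top_of_le_ne_top ENNReal.one_ne_top hinvp)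
    (by rw [one_div, one_div]; exact ENNReal.inv_le_inv.mpr hpq)
  set γ : ℝ := 1 - α + β with hγ
  have hγ0 : 0 < γ := by linarith
  have hγ1 : γ ≤ 1 := by linarith
  have ha : (n : ℝ) / m * (1 - γ) < 1 := by
    rw [div_mul_eq_mul_div, div_lt_one hmpos]
    rw [lt_div_iff₀ hnpos] at hup
    rw [hγ]; linarith
  set H : SchwartzMap (EuclideanSpace ℝ (Fin n)) ℂ := 𝓕⁻ g with hH
  obtain ⟨C, hC, hK⟩ := Kdom_norm hm H γ hγ0 hγ1 ha
  refine ⟨C, hC, fun t ht f => ?_⟩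
  have hexp : -((n : ℝ) / m) * (α - β) = -((n : ℝ) / m * (1 - γ)) := by rw [hγ]; ring
  rw [hexp]
  refine le_trans ?_ (mul_le_mul_left (hK t ht) _)
  have hpt := pointwise_bound hm Pf hcont h0 hs g hg t ht f
  have hKm := Kdom_meas m H H.continuous t
  have hfm : Measurable fun y => ‖f y‖ₑ := f.continuous.measurable.enorm
  have hp0 : p ≠ 0 := (zero_lt_one.trans_le hp).ne'
  have hq0 : q ≠ 0 := (zero_lt_one.trans_le (hp.trans hpq)).ne'
  by_cases hq : q = ⊤
  · have hβz : β = 0 := by rw [hβ, hq]; simp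
    subst hq
    rw [eLpNorm_exponent_top]
    refine eLpNormEssSup_le_of_ae_enorm_bound (Filter.Eventually.of_forall fun x => ?_)
    refine (hpt x).trans ?_
    by_cases hp' : p = ⊤
    · have hαz : α = 0 := by rw [hα, hp']; simp
      have hγe : γ = 1 := by rw [hγ, hαz, hβz]; ring
      subst hp'
      rw [hγe, eLpNorm_exponent_top]
      simp only [div_one, ENNReal.rpow_one]
      calc _ ≤ ∫⁻ y, eLpNormEssSup (⇑f) volume * Kdom m H t (x - y) := by
            apply lintegral_mono_ae
            filter_upwards [enorm_ae_le_eLpNormEssSup (⇑f) volume] with y hy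
            gcongr
        _ = eLpNormEssSup (⇑f) volume * ∫⁻ y, Kdom m H t (x - y) :=
            lintegral_const_mul _ (hKm.comp (measurable_id.const_sub x))
        _ = _ := by rw [lintegral_sub_left_eq_self (fun y => Kdom m H t y) x, mul_comm]
    · have hα0 : 0 < α := by
        rw [hα, one_div]
        exact ENNReal.toReal_pos (ENNReal.inv_ne_zero.mpr hp') (ENNReal.inv_ne_top.mpr hp0)
      have hpr : p.toReal = 1 / α := by rw [hα, one_div, one_div, ENNReal.toReal_inv, inv_inv]
      refine (holder_conv (fun y => ‖f y‖ₑ) _ hfm hKm α γ hα0 (by linarith)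
        (by rw [hγ, hβz]; ring) x).trans ?_
      rw [eLpNorm_eq_lintegral_rpow_enorm_toReal hp0 hp', hpr, one_div_one_div, mul_comm]
  · have hp' : p ≠ ⊤ := ne_top_of_le_ne_top hq hpq
    have hβ0 : 0 < β := by
      rw [hβ, one_div]
      exact ENNReal.toReal_pos (ENNReal.inv_ne_zero.mpr hq) (ENNReal.inv_ne_top.mpr hq0)
    have hpr : p.toReal = 1 / α := by rw [hα, one_div, one_div, ENNReal.toReal_inv, inv_inv]
    have hqr : q.toReal = 1 / β := by rw [hβ, one_div, one_div, ENNReal.toReal_inv, inv_inv]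
    rw [eLpNorm_eq_lintegral_rpow_enorm_toReal hp0 hp', hpr, one_div_one_div,
      eLpNorm_eq_lintegral_rpow_enorm_toReal hq0 hq, hqr, one_div_one_div, mul_comm]
    have hy := young_fin (fun y => ‖f y‖ₑ) _ hfm hKm α β γ hβ0 hβα hα1 hγ
    have hmono : ∫⁻ x, ‖IFT (fun ξ => ((1 + t * Pf ξ : ℝ) : ℂ)⁻¹ * FT (⇑f) ξ) x‖ₑ ^ (1 / β) ≤
        ∫⁻ x, (∫⁻ y, ‖f y‖ₑ * Kdom m H t (x - y)) ^ (1 / β) := by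
      apply lintegral_mono
      intro x
      exact ENNReal.rpow_le_rpow (hpt x) (by positivity)
    have := ENNReal.rpow_le_rpow (hmono.trans hy) hβ0.le
    rwa [← ENNReal.rpow_mul, one_div_mul_cancel hβ0.ne', ENNReal.rpow_one] at this
end
end
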